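/- arXiv:2412.12515 — 2 statements merged into one kernel-verified Lean document; each statement's English description precedes it below -/
import Mathlib

section
/- There exists an absolute constant C > 0 such that for every real x ≥ e^{2e} and every real α with 1/log x ≤ α ≤ 10, one has ∑_{p ≤ x} cos(α log p)/p ≤ log(1/α) + C, where the sum runs over primes p ≤ x. -/
open ArithmeticFunction.vonMangoldt in
/-- The Dirichlet series of the von Mangoldt function is `O(1 / (x - 1))` as `x → 1⁺`. -/
lemma tsum_vonMangoldt_div_rpow_le :
    ∃ C : ℝ, 0 ≤ C ∧ ∀ x : ℝ, x ∈ Set.Ioc (1 : ℝ) 2 →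
      Summable (fun n : ℕ ↦ ArithmeticFunction.vonMangoldt n / (n : ℝ) ^ x) ∧
      ∑' n : ℕ, ArithmeticFunction.vonMangoldt n / (n : ℝ) ^ x ≤ 1 / (x - 1) + C := by
  have ha : IsUnit (1 : ZMod 1) := isUnit_one
  have hres (n : ℕ) :
      residueClass (1 : ZMod 1) n = ArithmeticFunction.vonMangoldt n := by
    simp [residueClass, Subsingleton.elim (n : ZMod 1) 1]
  have H {x : ℝ} (hx : 1 < x) :
      ∑' n : ℕ, ArithmeticFunction.vonMangoldt n / (n : ℝ) ^ x =
        (LFunctionResidueClassAux (1 : ZMod 1) x).re + 1 / (x - 1) := by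
    refine Complex.ofReal_injective ?_
    simp only [Complex.ofReal_tsum, Complex.ofReal_div, Complex.ofReal_cpow (Nat.cast_nonneg _),
      Complex.ofReal_natCast, Complex.ofReal_add, Complex.ofReal_sub, Complex.ofReal_one]
    rw [← LFunctionResidueClassAux_real ha hx,
      eqOn_LFunctionResidueClassAux ha <| Set.mem_ofPred.mpr (Complex.ofReal_re x ▸ hx)]
    simp only [Nat.totient_one, Nat.cast_one, inv_one, sub_add_cancel, LSeries, LSeries.term]
    refine tsum_congr fun n ↦ ?_
    split_ifs with hn
    · simp [hn]
    · simp [hres]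
  have hcont : ContinuousOn (fun x : ℝ ↦ (LFunctionResidueClassAux (1 : ZMod 1) x).re)
      (Set.Icc 1 2) :=
    Complex.continuous_re.continuousOn.comp (t := Set.univ)
      (continuousOn_LFunctionResidueClassAux 1) (fun _ _ ↦ trivial) |>.comp
      Complex.continuous_ofReal.continuousOn fun x hx ↦ by
        simpa only [Set.mem_ofPred_eq, Complex.ofReal_re] using hx.1
  obtain ⟨C, hC⟩ := isCompact_Icc.bddAbove_image hcont
  refine ⟨max C 0, le_max_right _ _, fun x hx ↦ ⟨?_, ?_⟩⟩
  · have := LSeries.summable_real_of_abscissaOfAbsConv_lt (f := residueClass (1 : ZMod 1)) (x := x)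
      ((abscissaOfAbsConv_residueClass_le_one _).trans_lt <| mod_cast hx.1)
    simpa only [hres] using this
  · rw [H hx.1, add_comm]
    gcongr
    exact (hC (Set.mem_image_of_mem _ (Set.Ioc_subset_Icc_self hx))).trans (le_max_left _ _)

lemma tsum_primes_log_mul_rpow_le :
    ∃ C : ℝ, 0 ≤ C ∧ ∀ x : ℝ, x ∈ Set.Ioc (1 : ℝ) 2 →
      Summable (fun p : Nat.Primes ↦ Real.log p * (p : ℝ) ^ (-x)) ∧
      ∑' p : Nat.Primes, Real.log p * (p : ℝ) ^ (-x) ≤ 1 / (x - 1) + C := by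
  obtain ⟨C, hC0, hC⟩ := tsum_vonMangoldt_div_rpow_le
  refine ⟨C, hC0, fun x hx ↦ ?_⟩
  obtain ⟨hs, hle⟩ := hC x hx
  have hinj : Function.Injective (fun p : Nat.Primes ↦ (p : ℕ)) := Subtype.val_injective
  have heq : (fun p : Nat.Primes ↦ Real.log p * (p : ℝ) ^ (-x)) =
      (fun n : ℕ ↦ ArithmeticFunction.vonMangoldt n / (n : ℝ) ^ x) ∘ fun p : Nat.Primes ↦ (p : ℕ) := by
    ext p
    simp [ArithmeticFunction.vonMangoldt_apply_prime p.2, Real.rpow_neg, div_eq_mul_inv]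
  rw [heq]
  exact ⟨hs.comp_injective hinj, (tsum_comp_le_tsum_of_inj hs
    (fun n ↦ div_nonneg ArithmeticFunction.vonMangoldt_nonneg (by positivity)) hinj).trans hle⟩

/-- `(s - 1) ζ(s)` is bounded on bounded sets. -/
lemma exists_norm_sub_one_mul_riemannZeta_le (R : ℝ) :
    ∃ M : ℝ, 0 < M ∧ ∀ s : ℂ, s ≠ 1 → ‖s‖ ≤ R → ‖(s - 1) * riemannZeta s‖ ≤ M := by
  have hcont := (DirichletCharacter.differentiable_LFunctionTrivChar₁ 1).continuous
  obtain ⟨M, hM⟩ := (isCompact_closedBall (0 : ℂ) R).exists_bound_of_continuousOn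
    hcont.continuousOn
  refine ⟨max M 1, by positivity, fun s hs hsR ↦ ?_⟩
  have h := hM s (by simpa using hsR)
  rw [DirichletCharacter.LFunctionTrivChar₁, Function.update_of_ne hs,
    DirichletCharacter.LFunctionTrivChar, DirichletCharacter.LFunction_modOne_eq] at h
  exact h.trans (le_max_left _ _)

lemma summable_primes_cpow {s : ℂ} (hs : 1 < s.re) :
    Summable (fun p : Nat.Primes ↦ (p : ℂ) ^ (-s)) := by
  refine Summable.of_norm ?_
  have h : (fun p : Nat.Primes ↦ ‖(p : ℂ) ^ (-s)‖) = fun p : Nat.Primes ↦ (p : ℝ) ^ (-s.re) := by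
    ext p
    rw [Complex.norm_natCast_cpow_of_pos p.2.pos, Complex.neg_re]
  rw [h]
  exact Nat.Primes.summable_rpow.mpr (by linarith)

lemma re_le_re_neg_log_one_sub {z : ℂ} (hz : ‖z‖ ≤ 1 / 2) :
    z.re ≤ (-Complex.log (1 - z)).re + ‖z‖ ^ 2 := by
  have h := Complex.norm_log_one_add_sub_self_le (z := -z) (by rw [norm_neg]; linarith)
  rw [norm_neg] at h
  have h2 : (1 - ‖z‖)⁻¹ ≤ 2 := by
    rw [inv_le_comm₀ (by linarith) (by norm_num)]; linarith
  have h3 : ‖z‖ ^ 2 * (1 - ‖z‖)⁻¹ / 2 ≤ ‖z‖ ^ 2 := by nlinarith [sq_nonneg ‖z‖]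
  have h4 := (Complex.re_le_norm _).trans (h.trans h3)
  simp only [Complex.sub_re, Complex.neg_re, ← sub_eq_add_neg] at h4 ⊢
  linarith

/-- On `1 < re s`, the real part of the prime zeta function is at most `log ‖ζ(s)‖ + O(1)`. -/
lemma tsum_primes_re_cpow_le :
    ∃ K : ℝ, ∀ s : ℂ, 1 < s.re →
      ∑' p : Nat.Primes, ((p : ℂ) ^ (-s)).re ≤ Real.log ‖riemannZeta s‖ + K := by
  have hsq : Summable (fun p : Nat.Primes ↦ (p : ℝ) ^ (-2 : ℝ)) :=
    Nat.Primes.summable_rpow.mpr (by norm_num)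
  refine ⟨∑' p : Nat.Primes, (p : ℝ) ^ (-2 : ℝ), fun s hs ↦ ?_⟩
  have hlog : Summable (fun p : Nat.Primes ↦ -Complex.log (1 - (p : ℂ) ^ (-s))) := by
    simpa [MulChar.one_apply <| isUnit_of_subsingleton _] using
      DirichletCharacter.summable_neg_log_one_sub_mul_prime_cpow (1 : DirichletCharacter ℂ 1) hs
  rw [← riemannZeta_eulerProduct_exp_log hs, Complex.norm_exp, Real.log_exp, Complex.re_tsum hlog,
    ← (Complex.hasSum_re hlog.hasSum).summable.tsum_add hsq]
  refine Summable.tsum_le_tsum (fun p ↦ ?_)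
    (Complex.hasSum_re (summable_primes_cpow hs).hasSum).summable
    ((Complex.hasSum_re hlog.hasSum).summable.add hsq)
  have hp1 : (1 : ℝ) ≤ p := mod_cast p.2.one_le
  have hn : ‖(p : ℂ) ^ (-s)‖ ≤ (p : ℝ) ^ (-1 : ℝ) := by
    rw [Complex.norm_natCast_cpow_of_pos p.2.pos, Complex.neg_re]
    exact Real.rpow_le_rpow_of_exponent_le hp1 (by linarith)
  have h2 : (p : ℝ) ^ (-1 : ℝ) ≤ 1 / 2 := by
    rw [Real.rpow_neg_one, ← one_div]
    exact one_div_le_one_div_of_le (by norm_num) (mod_cast p.2.two_le)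
  refine (re_le_re_neg_log_one_sub (hn.trans h2)).trans ?_
  gcongr
  calc ‖(p : ℂ) ^ (-s)‖ ^ 2 ≤ ((p : ℝ) ^ (-1 : ℝ)) ^ 2 := by gcongr
    _ = (p : ℝ) ^ (-2 : ℝ) := by
      rw [← Real.rpow_mul_natCast (by positivity)]; norm_num

lemma re_natCast_cpow_neg {n : ℕ} (hn : 0 < n) (σ t : ℝ) :
    ((n : ℂ) ^ (-(σ + t * Complex.I))).re = (n : ℝ) ^ (-σ) * Real.cos (t * Real.log n) := by
  have hn' : (n : ℂ) ≠ 0 := mod_cast hn.ne'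
  rw [Complex.cpow_def_of_ne_zero hn', Complex.exp_re, ← Complex.natCast_log,
    Real.rpow_def_of_pos (mod_cast hn)]
  have h (r : ℝ) : (r * -(σ + t * Complex.I) : ℂ) = (r * -σ : ℝ) + (-(t * r) : ℝ) * Complex.I := by
    push_cast; ring
  have hre (a b : ℝ) : ((a : ℂ) + (b : ℂ) * Complex.I).re = a := by simp
  have him (a b : ℝ) : ((a : ℂ) + (b : ℂ) * Complex.I).im = b := by simp
  rw [h, hre, him, Real.cos_neg]

/-- Replacing `1 / p` by `p ^ (-(1 + 1 / log x))` for `p ≤ x` costs `O(log p / log x)`. -/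
lemma cos_div_le {n : ℕ} (hn : 1 ≤ n) {L : ℝ} (hL : 0 < L) (hnL : Real.log n ≤ L) (c : ℝ)
    (hc : c ≤ 1) :
    c / n ≤ (n : ℝ) ^ (-(1 + 1 / L)) * c +
      Real.exp 1 / L * (Real.log n * (n : ℝ) ^ (-(1 + 1 / L))) := by
  have hn0 : (0 : ℝ) < n := mod_cast hn
  have hlog : 0 ≤ Real.log n := Real.log_natCast_nonneg n
  set u := Real.log n / L with hu
  have hu0 : 0 ≤ u := by positivity
  have hu1 : u ≤ 1 := (div_le_one hL).mpr hnL
  set w := (n : ℝ) ^ (-(1 + 1 / L)) with hw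
  have hw0 : 0 < w := by positivity
  have h1 : 1 / (n : ℝ) = w * Real.exp u := by
    rw [hw, Real.rpow_def_of_pos hn0, ← Real.exp_add, one_div, ← Real.exp_log hn0, ← Real.exp_neg,
      Real.log_exp]
    congr 1
    rw [hu]; ring
  have h2 : Real.exp u - 1 ≤ Real.exp 1 * u := by
    have h3 := Real.add_one_le_exp (-u)
    have h4 : Real.exp (-u) * Real.exp u = 1 := by rw [← Real.exp_add]; simp
    have h5 : Real.exp u ≤ Real.exp 1 := Real.exp_le_exp.mpr hu1
    have h6 := Real.exp_pos u
    nlinarith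
  have h7 : 0 ≤ Real.exp u - 1 := by linarith [Real.one_le_exp hu0]
  have h8 : c * (Real.exp u - 1) ≤ Real.exp 1 * u := by nlinarith
  calc c / n = w * c + w * (c * (Real.exp u - 1)) := by
        rw [div_eq_mul_one_div, h1]; ring
    _ ≤ w * c + w * (Real.exp 1 * u) := by gcongr
    _ = _ := by rw [hu]; ring

/-- For `L < log p`, the term `p ^ (-(1 + 1 / L))` is dominated by its multiple by `log p / L`. -/
lemma rpow_mul_cos_add_nonneg {n : ℕ} {L : ℝ} (hL : 0 < L) (hnL : L ≤ Real.log n) (c y : ℝ)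
    (hc : -1 ≤ c) :
    0 ≤ (n : ℝ) ^ y * c + Real.exp 1 / L * (Real.log n * (n : ℝ) ^ y) := by
  have h1 : 1 ≤ Real.log n / L := (one_le_div hL).mpr hnL
  have h2 : 1 ≤ Real.exp 1 := Real.one_le_exp zero_le_one
  have h3 : 1 ≤ Real.exp 1 * (Real.log n / L) := by nlinarith
  have h4 : (n : ℝ) ^ y * c + Real.exp 1 / L * (Real.log n * (n : ℝ) ^ y) =
    (n : ℝ) ^ y * (c + Real.exp 1 * (Real.log n / L)) := by ring
  rw [h4]
  exact mul_nonneg (by positivity) (by linarith)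


/-- Unconditionally, for `x ≥ e^{2e}` and `1/log x ≤ α ≤ 10`,
`∑_{p ≤ x} cos(α log p)/p ≤ log(1/α) + O(1)` with an absolute implied constant. -/
theorem stmt_2 :
    ∃ C : ℝ, 0 < C ∧
      ∀ x : ℝ, Real.exp (2 * Real.exp 1) ≤ x →
        ∀ α : ℝ, 1 / Real.log x ≤ α → α ≤ 10 →
          (∑ p ∈ (Finset.Iic ⌊x⌋₊).filter Nat.Prime, Real.cos (α * Real.log p) / p)
            ≤ Real.log (1 / α) + C := by

  obtain ⟨A, hA0, hA⟩ := tsum_primes_log_mul_rpow_le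
  obtain ⟨K, hK⟩ := tsum_primes_re_cpow_le
  obtain ⟨M, hM0, hM⟩ := exists_norm_sub_one_mul_riemannZeta_le 12
  refine ⟨|Real.log M + K| + Real.exp 1 * (1 + A), by positivity, fun x hx α hα hα10 ↦ ?_⟩
  have hx0 : 0 < x := (Real.exp_pos _).trans_le hx
  set L := Real.log x with hLdef
  have hL1 : 1 ≤ L := by
    have h := (Real.le_log_iff_exp_le hx0).mpr hx
    linarith [Real.one_le_exp (zero_le_one (α := ℝ))]
  have hL : 0 < L := by linarith
  have hα0 : 0 < α := lt_of_lt_of_le (by positivity) hα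
  have hiL : 1 / L ≤ 1 := (div_le_one hL).mpr hL1
  have hiL0 : 0 < 1 / L := by positivity
  set σ : ℝ := 1 + 1 / L with hσ
  set s : ℂ := σ + α * Complex.I with hs
  have hsre : s.re = σ := by simp [hs]
  have hs1 : 1 < s.re := by rw [hsre]; linarith
  have hsim : s.im = α := by simp [hs]
  have hsne : s ≠ 1 := fun h ↦ by simp [h] at hs1
  obtain ⟨hAs, hAle⟩ := hA σ ⟨by linarith, by linarith⟩
  have hre : Summable (fun p : Nat.Primes ↦ ((p : ℂ) ^ (-s)).re) :=
    (Complex.hasSum_re (summable_primes_cpow hs1).hasSum).summable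
  have hzeta : Real.log ‖riemannZeta s‖ ≤ Real.log M + Real.log (1 / α) := by
    have h12 : ‖s‖ ≤ 12 := by
      refine (Complex.norm_le_abs_re_add_abs_im s).trans ?_
      rw [hsre, hsim, abs_of_pos (by linarith), abs_of_pos hα0]
      linarith
    have h := hM s hsne h12
    have hαs : α ≤ ‖s - 1‖ := by
      have := Complex.abs_im_le_norm (s - 1)
      simp only [Complex.sub_im, Complex.one_im, sub_zero, hsim] at this
      exact (le_abs_self α).trans this
    have hz0 : 0 < ‖riemannZeta s‖ :=
      norm_pos_iff.mpr (riemannZeta_ne_zero_of_one_le_re hs1.le)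
    rw [← Real.log_mul hM0.ne' (by positivity)]
    refine Real.log_le_log hz0 ?_
    rw [mul_one_div, le_div_iff₀ hα0, mul_comm]
    rw [norm_mul] at h
    exact (mul_le_mul_of_nonneg_right hαs hz0.le).trans h
  have hgs := hre.add (hAs.mul_left (Real.exp 1 / L))
  obtain ⟨T, hT⟩ : ∃ T : Finset Nat.Primes, T = (Finset.Iic ⌊x⌋₊).subtype Nat.Prime := ⟨_, rfl⟩
  have hmem (p : Nat.Primes) : p ∈ T ↔ Real.log p ≤ L := by
    rw [hT, hLdef, Real.log_le_log_iff (mod_cast p.2.pos) hx0, ← Nat.le_floor_iff hx0.le,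
      ← Finset.mem_Iic]
    exact Finset.mem_subtype
  calc ∑ p ∈ (Finset.Iic ⌊x⌋₊).filter Nat.Prime, Real.cos (α * Real.log p) / p
      = ∑ p ∈ T, Real.cos (α * Real.log p) / p := by
        rw [hT]
        exact (Finset.sum_subtype_eq_sum_filter fun p : ℕ ↦ Real.cos (α * Real.log p) / p).symm
    _ ≤ ∑ p ∈ T, (((p : ℂ) ^ (-s)).re +
          Real.exp 1 / L * (Real.log p * (p : ℝ) ^ (-σ))) := by
        refine Finset.sum_le_sum fun p hp ↦ ?_
        rw [hs, re_natCast_cpow_neg p.2.pos]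
        exact cos_div_le p.2.one_le hL ((hmem p).mp hp) _ (Real.cos_le_one _)
    _ ≤ ∑' p : Nat.Primes, (((p : ℂ) ^ (-s)).re +
          Real.exp 1 / L * (Real.log p * (p : ℝ) ^ (-σ))) := by
        refine hgs.sum_le_tsum _ fun p hp ↦ ?_
        rw [hs, re_natCast_cpow_neg p.2.pos]
        exact rpow_mul_cos_add_nonneg hL (not_le.mp (mt (hmem p).mpr hp)).le _ _
          (Real.neg_one_le_cos _)
    _ = ∑' p : Nat.Primes, ((p : ℂ) ^ (-s)).re +
          Real.exp 1 / L * ∑' p : Nat.Primes, Real.log p * (p : ℝ) ^ (-σ) := by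
        rw [hre.tsum_add (hAs.mul_left _), tsum_mul_left]
    _ ≤ (Real.log M + Real.log (1 / α) + K) + Real.exp 1 / L * (L + A) := by
        have h1 : 1 / (σ - 1) = L := by simp [hσ]
        rw [h1] at hAle
        gcongr
        exact (hK s hs1).trans (by gcongr)
    _ ≤ Real.log (1 / α) + (|Real.log M + K| + Real.exp 1 * (1 + A)) := by
        have h1 : Real.exp 1 / L * (L + A) = Real.exp 1 * (1 + 1 / L * A) := by field_simp
        have h2 : 1 / L * A ≤ A := by nlinarith
        have h3 : Real.exp 1 * (1 + 1 / L * A) ≤ Real.exp 1 * (1 + A) := by gcongr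
        rw [h1]
        linarith [le_abs_self (Real.log M + K)]
end

section
/- Let Φ : ℝ → ℝ be a non-negative smooth function with compact support contained in the positive real numbers, let k ≥ 0 be a real number, and let ε > 0. Then there is a constant C > 0 (depending only on k, ε and Φ) such that for all real X ≥ 1 and all odd positive integers n, | ∑_{d ≥ 1 odd, squarefree} A(d)^{-k} χ^{(8d)}(n) Φ(d/X) − δ_{n=□} · \hatΦ(1) · (X/2) · ∏_{p | n} (1 + A(p)^{-k}/p)^{-1} · ∏_{p odd prime} (1 − 1/p)(1 + A(p)^{-k}/p) | ≤ C X^{1/2+ε} n^{1/4+ε}, where δ_{n=□} = 1 if n is a perfect square and δ_{n=□} = 0 otherwise, the first product runs over the prime divisors of n, and the second (convergent) infinite product runs over all odd primes. -/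
/-- `A(d) = ∏_{p ∣ d} (1 - 1/p)`, the product over the prime divisors of `d`. -/
noncomputable def A (d : ℕ) : ℝ := ∏ p ∈ d.primeFactors, (1 - 1 / (p : ℝ))

/-- The Kronecker symbol `χ^{(8d)}(n) = (8d/n)`: it agrees with the Jacobi symbol for odd `n`,
and vanishes for even `n` (since `8d` is even). -/
noncomputable def chi8 (d n : ℕ) : ℤ := if n % 2 = 1 then jacobiSym (8 * d) n else 0

section CharacterSums

open scoped FourierTransform SchwartzMap ComplexConjugate ContDiff

theorem norm_gaussSum_of_isPrimitive {N : ℕ} [NeZero N] {χ : DirichletCharacter ℂ N}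
    (hχ : χ.IsPrimitive) : ‖gaussSum χ (ZMod.stdAddChar (N := N))‖ = √N := by
  set e : AddChar (ZMod N) ℂ := ZMod.stdAddChar
  have he : e.IsPrimitive := ZMod.isPrimitive_stdAddChar N
  set τ := gaussSum χ e
  have hconj : conj τ = ∑ a : ZMod N, χ⁻¹ a * e (-a) := by
    simp only [τ, gaussSum, map_sum, map_mul]
    refine Finset.sum_congr rfl fun a _ => ?_
    rw [AddChar.starComp_apply (by rw [ZMod.ringChar_zmod_n]; exact NeZero.pos N), AddChar.inv_apply,
      ← MulChar.star_apply', RCLike.star_def]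
  have h : τ * conj τ = N := by
    calc τ * conj τ = ∑ a : ZMod N, gaussSum χ (e.mulShift a) * e (-a) := by
          rw [hconj, Finset.mul_sum]
          refine Finset.sum_congr rfl fun a _ => ?_
          rw [gaussSum_mulShift_of_isPrimitive e hχ a]; ring
      _ = ∑ b : ZMod N, χ b * ∑ a : ZMod N, e (a * (b - 1)) := by
          simp only [gaussSum, Finset.sum_mul, Finset.mul_sum]
          rw [Finset.sum_comm]
          refine Finset.sum_congr rfl fun b _ => Finset.sum_congr rfl fun a _ => ?_
          rw [AddChar.mulShift_apply, mul_assoc, ← AddChar.map_add_eq_mul]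
          congr 2; ring
      _ = N := by
          simp_rw [AddChar.sum_mulShift _ he, sub_eq_zero]
          simp
  rw [Complex.mul_conj, Complex.normSq_eq_norm_sq] at h
  have h' : ‖τ‖ ^ 2 = N := by exact_mod_cast h
  rw [← h', Real.sqrt_sq (norm_nonneg _)]

theorem norm_gaussSum_mulShift_le {N : ℕ} [NeZero N] {χ : DirichletCharacter ℂ N}
    (hχ : χ.IsPrimitive) (a : ZMod N) :
    ‖gaussSum χ ((ZMod.stdAddChar (N := N)).mulShift a)‖ ≤ √N := by
  rw [gaussSum_mulShift_of_isPrimitive _ hχ, norm_mul, norm_gaussSum_of_isPrimitive hχ]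
  exact mul_le_of_le_one_left (by positivity) (DirichletCharacter.norm_le_one _ _)

theorem tsum_nat_div_sq_le {t : ℝ} (ht : 0 < t) :
    Summable (fun a : ℕ => 1 / (1 + (a + 1) * t) ^ 2) ∧
      ∑' a : ℕ, 1 / (1 + (a + 1) * t) ^ 2 ≤ 1 / t := by
  have key : ∀ n : ℕ, ∑ a ∈ Finset.range n, 1 / (1 + ((a : ℝ) + 1) * t) ^ 2 ≤ 1 / t := by
    intro n
    have h : ∑ a ∈ Finset.range n, 1 / (1 + ((a : ℝ) + 1) * t) ^ 2 ≤
        1 / t - 1 / (t * (1 + n * t)) := by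
      induction n with
      | zero => simp
      | succ n ih =>
        rw [Finset.sum_range_succ]
        have : 1 / (1 + ((n : ℝ) + 1) * t) ^ 2 ≤
            1 / (t * (1 + n * t)) - 1 / (t * (1 + (n + 1) * t)) := by
          have : 1 / (t * (1 + n * t)) - 1 / (t * (1 + (n + 1) * t)) =
              1 / ((1 + n * t) * (1 + (n + 1) * t)) := by field_simp; ring
          rw [this, sq]
          gcongr
          linarith
        push_cast
        linarith
    exact h.trans (sub_le_self _ (by positivity))
  exact ⟨summable_of_sum_range_le (fun _ => by positivity) key,
    Real.tsum_le_of_sum_range_le (fun _ => by positivity) key⟩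

theorem tsum_int_div_sq_le {t : ℝ} (ht : 0 < t) :
    Summable (fun a : ℤ => 1 / (1 + |(a : ℝ)| * t) ^ 2) ∧
      ∑' a : ℤ, (if a = 0 then 0 else 1 / (1 + |(a : ℝ)| * t) ^ 2) ≤ 2 / t := by
  obtain ⟨hs, hle⟩ := tsum_nat_div_sq_le ht
  have e1 : ∀ n : ℕ, |((-((n : ℤ) + 1) : ℤ) : ℝ)| = n + 1 := fun n => by
    push_cast; rw [abs_neg, abs_of_nonneg (by positivity)]
  have e2 : ∀ n : ℕ, |(((n : ℤ) + 1 : ℤ) : ℝ)| = n + 1 := fun n => by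
    push_cast; rw [abs_of_nonneg (by positivity)]
  refine ⟨?_, ?_⟩
  · refine Summable.of_add_one_of_neg_add_one ?_ ?_
    · simpa only [e2] using hs
    · simpa only [e1] using hs
  · have h1 : ∀ n : ℕ, ((n : ℤ) + 1) ≠ 0 := fun n => by omega
    have h2 : ∀ n : ℕ, (-((n : ℤ) + 1)) ≠ 0 := fun n => by omega
    rw [tsum_of_add_one_of_neg_add_one]
    · simp only [h1, h2, if_false, e1, e2]
      have : 2 / t = 1 / t + 1 / t := by ring
      simp only [if_true]
      linarith
    · simpa only [h1, if_false, e2] using hs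
    · simpa only [h2, if_false, e1] using hs

theorem fourier_comp_mul_left (Φ : ℝ → ℂ) {c : ℝ} (hc : 0 < c) (ξ : ℝ) :
    𝓕 (fun x => Φ (c * x)) ξ = (c⁻¹ : ℝ) * 𝓕 Φ (ξ / c) := by
  rw [Real.fourier_real_eq, Real.fourier_real_eq]
  have := MeasureTheory.Measure.integral_comp_mul_left
    (fun v => Real.fourierChar (-(v * (ξ / c))) • Φ v) c
  rw [abs_of_pos (inv_pos.2 hc), Complex.real_smul] at this
  rw [← this]
  congr 1 with v
  congr 3
  field_simp

theorem exists_fourier_decay {Φ : ℝ → ℂ} (h1 : HasCompactSupport Φ) (h2 : ContDiff ℝ ∞ Φ) :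
    ∃ K : ℝ, 0 < K ∧ ∀ ξ : ℝ, ‖𝓕 Φ ξ‖ ≤ K * (1 / (1 + |ξ|) ^ 2) := by
  let f : 𝓢(ℝ, ℂ) := h1.toSchwartzMap h2
  have h := SchwartzMap.one_add_le_sup_seminorm_apply (𝕜 := ℂ) (m := (2, 0)) (k := 2) (n := 0)
    le_rfl le_rfl (𝓕 f)
  set K := 2 ^ 2 * (Finset.Iic (2, 0)).sup (fun m => SchwartzMap.seminorm ℂ m.1 m.2) (𝓕 f)
  refine ⟨max K 1, by positivity, fun ξ => ?_⟩
  have h := h ξ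
  rw [norm_iteratedFDeriv_zero, Real.norm_eq_abs, SchwartzMap.fourier_coe] at h
  rw [mul_one_div, le_div_iff₀ (by positivity), mul_comm]
  exact h.trans (le_max_left _ _)

theorem tsum_residue_eq_tsum_fourier {Φ : ℝ → ℂ} (h1 : HasCompactSupport Φ) (h2 : ContDiff ℝ ∞ Φ)
    {N : ℕ} [NeZero N] {Y : ℝ} (hY : 0 < Y) (b : ℤ) :
    ∑' q : ℤ, Φ (((q * N + b : ℤ) : ℝ) / Y) =
      ∑' a : ℤ, ((Y / N : ℝ) : ℂ) * 𝓕 Φ (a * (Y / N)) *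
        ZMod.stdAddChar ((a * b : ℤ) : ZMod N) := by
  have hN : (0 : ℝ) < N := by exact_mod_cast NeZero.pos N
  have hc : 0 < N / Y := by positivity
  have hg1 : HasCompactSupport (fun x => Φ (N / Y * x)) :=
    h1.comp_homeomorph (Homeomorph.mulLeft₀ (N / Y) hc.ne')
  have hg2 : ContDiff ℝ ∞ (fun x => Φ (N / Y * x)) := h2.comp (by fun_prop)
  have h := SchwartzMap.tsum_eq_tsum_fourier (hg1.toSchwartzMap hg2) (b / N : ℝ)
  rw [SchwartzMap.fourier_coe] at h
  change ∑' n : ℤ, Φ (N / Y * (b / N + n)) = ∑' n : ℤ, 𝓕 (fun x => Φ (N / Y * x)) n * _ at h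
  convert h using 3 with q a
  · congr 1
    push_cast
    field_simp
    ring
  · rw [fourier_comp_mul_left Φ hc, fourier_coe_apply, ZMod.stdAddChar_coe, inv_div, div_div_eq_mul_div,
      mul_div_assoc]
    congr 2
    all_goals push_cast; ring_nf

theorem finite_support_comp_div {Φ : ℝ → ℂ} (h1 : HasCompactSupport Φ) {Y : ℝ} (hY : 0 < Y) :
    (Function.support fun m : ℤ => Φ (m / Y)).Finite := by
  obtain ⟨R, hR⟩ := h1.isBounded.subset_closedBall 0
  refine (Set.finite_Icc (-⌈R * Y⌉) ⌈R * Y⌉).subset fun m hm => ?_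
  have := hR (subset_tsupport _ hm)
  rw [mem_closedBall_zero_iff, Real.norm_eq_abs, abs_div, abs_of_pos hY, div_le_iff₀ hY,
    abs_le] at this
  have h3 := Int.le_ceil (R * Y)
  constructor
  · have : (-⌈R * Y⌉ : ℝ) ≤ m := by linarith
    exact_mod_cast this
  · have : (m : ℝ) ≤ ⌈R * Y⌉ := by linarith
    exact_mod_cast this

theorem tsum_periodic_eq_tsum_fourier {Φ : ℝ → ℂ} (h1 : HasCompactSupport Φ)
    (h2 : ContDiff ℝ ∞ Φ) {N : ℕ} [NeZero N] {Y : ℝ} (hY : 0 < Y) (f : ZMod N → ℂ) :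
    ∑' m : ℤ, f m * Φ (m / Y) =
      ∑' a : ℤ, ((Y / N : ℝ) : ℂ) * 𝓕 Φ (a * (Y / N)) *
        ∑ b : ZMod N, f b * ZMod.stdAddChar ((a : ZMod N) * b) := by
  have hN : (0 : ℝ) < N := by exact_mod_cast NeZero.pos N
  have ht : 0 < Y / N := by positivity
  obtain ⟨K, hK, hdec⟩ := exists_fourier_decay h1 h2
  have hfin : (Function.support fun m : ℤ => f m * Φ (m / Y)).Finite :=
    (finite_support_comp_div h1 hY).subset (Function.support_mul_subset_right _ _)
  have hsum : Summable fun m : ℤ => f m * Φ (m / Y) := summable_of_hasFiniteSupport hfin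
  have hfs : ∀ b : ZMod N, Summable fun a : ℤ => ((Y / N : ℝ) : ℂ) * 𝓕 Φ (a * (Y / N)) *
      (f b * ZMod.stdAddChar ((a : ZMod N) * b)) := by
    intro b
    refine Summable.of_norm_bounded
      (((tsum_int_div_sq_le ht).1.mul_left (Y / N * K * ‖f b‖))) fun a => ?_
    rw [norm_mul, norm_mul, norm_mul, AddChar.norm_apply, mul_one, Complex.norm_real,
      Real.norm_of_nonneg ht.le]
    have := hdec (a * (Y / N))
    rw [abs_mul, abs_of_pos ht] at this
    calc _ ≤ Y / N * (K * (1 / (1 + |(a : ℝ)| * (Y / N)) ^ 2)) * ‖f b‖ := by gcongr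
      _ = _ := by ring
  calc ∑' m : ℤ, f m * Φ (m / Y)
      = ∑' p : ℤ × Fin N, f ((p.1 * N + p.2 : ℤ) : ZMod N) * Φ (((p.1 * N + p.2 : ℤ) : ℝ) / Y) := by
        rw [← (Int.divModEquiv N).symm.tsum_eq]
        rfl
    _ = ∑ b : Fin N, ∑' q : ℤ, f ((q * N + b : ℤ) : ZMod N) * Φ (((q * N + b : ℤ) : ℝ) / Y) := by
        have hs := (Int.divModEquiv N).symm.summable_iff.2 hsum
        rw [← (Equiv.prodComm (Fin N) ℤ).tsum_eq, Summable.tsum_prod, tsum_fintype]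
        · rfl
        · exact (Equiv.prodComm (Fin N) ℤ).summable_iff.2 hs
    _ = ∑ b : Fin N, ∑' a : ℤ, ((Y / N : ℝ) : ℂ) * 𝓕 Φ (a * (Y / N)) *
          (f ((b : ℕ) : ZMod N) * ZMod.stdAddChar ((a : ZMod N) * ((b : ℕ) : ZMod N))) := by
        refine Finset.sum_congr rfl fun b _ => ?_
        have : ∀ q : ℤ, ((q * N + (b : ℕ) : ℤ) : ZMod N) = ((b : ℕ) : ZMod N) := by simp
        simp_rw [this]
        rw [tsum_mul_left, tsum_residue_eq_tsum_fourier h1 h2 hY, ← tsum_mul_left]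
        congr 1 with a
        push_cast
        ring
    _ = ∑ b : ZMod N, ∑' a : ℤ, ((Y / N : ℝ) : ℂ) * 𝓕 Φ (a * (Y / N)) *
          (f b * ZMod.stdAddChar ((a : ZMod N) * b)) := by
        refine Fintype.sum_equiv (ZMod.finEquiv N).toEquiv _ _ fun b => ?_
        have : (ZMod.finEquiv N).toEquiv b = ((b : ℕ) : ZMod N) := by
          obtain _ | n := N
          · exact b.elim0
          · exact (Fin.cast_val_eq_self (n := n + 1) b).symm
        rw [this]
    _ = _ := by
        rw [← Summable.tsum_finsetSum fun b _ => hfs b]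
        simp_rw [Finset.mul_sum]

/-- A smoothed sum of a primitive character mod `N` is its main term up to `O(√N)`. -/
theorem exists_norm_primitive_sum_sub_le {Φ : ℝ → ℂ} (h1 : HasCompactSupport Φ)
    (h2 : ContDiff ℝ ∞ Φ) :
    ∃ C : ℝ, 0 < C ∧ ∀ (N : ℕ) [NeZero N] (χ : DirichletCharacter ℂ N), χ.IsPrimitive →
      ∀ Y : ℝ, 0 < Y →
        ‖∑' m : ℤ, χ m * Φ (m / Y) - (if N = 1 then 1 else 0) * (Y * ∫ t, Φ t)‖ ≤ C * √N := by
  obtain ⟨K, hK, hdec⟩ := exists_fourier_decay h1 h2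
  refine ⟨2 * K, by positivity, fun N _ χ hχ Y hY => ?_⟩
  have hN : (0 : ℝ) < N := by exact_mod_cast NeZero.pos N
  have ht : 0 < Y / N := by positivity
  have hG : ∀ a : ℤ, ∑ b : ZMod N, χ b * ZMod.stdAddChar ((a : ZMod N) * b) =
      gaussSum χ ((ZMod.stdAddChar (N := N)).mulShift a) := fun a => rfl
  set F : ℤ → ℂ := fun a => ((Y / N : ℝ) : ℂ) * 𝓕 Φ (a * (Y / N)) *
        gaussSum χ ((ZMod.stdAddChar (N := N)).mulShift a) with hF
  have hsum : ∑' m : ℤ, χ m * Φ (m / Y) = ∑' a, F a := by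
    rw [tsum_periodic_eq_tsum_fourier h1 h2 hY]
    simp only [hG, hF]
  have hFb : ∀ a, ‖F a‖ ≤ Y / N * K * √N * (1 / (1 + |(a : ℝ)| * (Y / N)) ^ 2) := by
    intro a
    rw [hF, norm_mul, norm_mul, Complex.norm_real, Real.norm_of_nonneg ht.le]
    have := hdec (a * (Y / N))
    rw [abs_mul, abs_of_pos ht] at this
    calc _ ≤ Y / N * (K * (1 / (1 + |(a : ℝ)| * (Y / N)) ^ 2)) * √N := by
          gcongr
          exact norm_gaussSum_mulShift_le hχ _
      _ = _ := by ring
  obtain ⟨hs, hle⟩ := tsum_int_div_sq_le ht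
  have hFs : Summable F := .of_norm_bounded (hs.mul_left _) hFb
  have hF0 : F 0 = (if N = 1 then 1 else 0) * (Y * ∫ t, Φ t) := by
    have : 𝓕 Φ 0 = ∫ t, Φ t := by simp [Real.fourier_real_eq]
    simp only [hF, Int.cast_zero, zero_mul, this, AddChar.mulShift_zero, gaussSum, AddChar.one_apply,
      mul_one]
    split_ifs with h
    · subst h
      rw [DirichletCharacter.level_one χ]
      have hone : ∑ b : ZMod 1, (1 : DirichletCharacter ℂ 1) b = 1 := by
        rw [Fintype.sum_eq_single 1 fun b hb => absurd (Subsingleton.elim b 1) hb]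
        exact map_one _
      rw [hone]
      simp
    · have hχ1 : χ ≠ 1 := by
        rintro rfl
        rw [DirichletCharacter.isPrimitive_def, DirichletCharacter.conductor_one] at hχ
        exact h hχ.symm
      rw [MulChar.sum_eq_zero_of_ne_one hχ1]
      simp
  have hs' : Summable fun a : ℤ => if a = 0 then 0 else 1 / (1 + |(a : ℝ)| * (Y / N)) ^ 2 := by
    refine .of_nonneg_of_le (fun a => ?_) (fun a => ?_) hs
    · split_ifs <;> positivity
    · split_ifs
      · positivity
      · exact le_rfl
  rw [hsum, hFs.tsum_eq_add_tsum_ite 0, hF0, add_sub_cancel_left]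
  calc ‖∑' a : ℤ, (if a = 0 then 0 else F a)‖
      ≤ Y / N * K * √N * ∑' a : ℤ, (if a = 0 then 0 else 1 / (1 + |(a : ℝ)| * (Y / N)) ^ 2) := by
        rw [← tsum_mul_left]
        refine tsum_of_norm_bounded (hs'.mul_left _).hasSum fun a => ?_
        split_ifs
        · simp
        · exact hFb a
    _ ≤ Y / N * K * √N * (2 / (Y / N)) := by gcongr
    _ = 2 * K * √N := by field_simp

/-- Coprimality conditions at the primes of `P` are imposed one prime at a time. -/
theorem norm_sum_coprime_sub_le {Φ : ℝ → ℂ} {ψ : ℕ →* ℂ} {E : ℂ} {B : ℝ}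
    (hψ : ∀ p, ‖ψ p‖ ≤ 1) (hE : E = 0 ∨ ∀ p : ℕ, p.Prime → ψ p = 1)
    (hΦ : ∀ Y : ℝ, 0 < Y → Summable fun m : ℕ => ψ m * Φ (m / Y))
    (hB : ∀ Y : ℝ, 0 < Y → ‖∑' m : ℕ, ψ m * Φ (m / Y) - E * Y‖ ≤ B)
    (P : Finset ℕ) (hP : ∀ p ∈ P, p.Prime) :
    ∀ Y : ℝ, 0 < Y → ‖∑' m : ℕ, (if ∀ p ∈ P, ¬ p ∣ m then ψ m * Φ (m / Y) else 0) -
      E * Y * ∏ p ∈ P, (1 - 1 / (p : ℂ))‖ ≤ 2 ^ P.card * B := by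
  induction P using Finset.induction_on with
  | empty => simpa using hB
  | insert p P hp ih =>
    intro Y hY
    have hpp := hP p (by simp)
    have hp0 : (0 : ℝ) < p := by exact_mod_cast hpp.pos
    have ih := ih fun q hq => hP q (by simp [hq])
    have i1 := ih Y hY
    have i2 := ih (Y / p) (by positivity)
    set S : ℝ → ℂ := fun Y => ∑' m : ℕ, (if ∀ q ∈ P, ¬ q ∣ m then ψ m * Φ (m / Y) else 0) with hS
    have hsm : Summable fun m : ℕ => (if ∀ q ∈ P, ¬ q ∣ m then ψ m * Φ (m / Y) else 0) :=
      (hΦ Y hY).norm.of_norm_bounded fun m => by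
        split_ifs <;> first | exact le_rfl | (rw [norm_zero]; positivity)
    have hinj : Function.Injective fun m : ℕ => p * m := fun a b h =>
      Nat.eq_of_mul_eq_mul_left hpp.pos h
    have hmult : ψ p * S (Y / p) =
        ∑' m : ℕ, (if p ∣ m then (if ∀ q ∈ P, ¬ q ∣ m then ψ m * Φ (m / Y) else 0) else 0) := by
      rw [← hinj.tsum_eq, hS, ← tsum_mul_left]
      · refine tsum_congr fun m => ?_
        have : (∀ q ∈ P, ¬ q ∣ p * m) ↔ (∀ q ∈ P, ¬ q ∣ m) := by
          refine forall₂_congr fun q hq => ?_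
          rw [(hP q (by simp [hq])).dvd_mul, Nat.prime_dvd_prime_iff_eq (hP q (by simp [hq])) hpp]
          have : q ≠ p := fun h => hp (h ▸ hq)
          tauto
        simp only [dvd_mul_right, if_true, this]
        split_ifs
        · rw [map_mul, mul_assoc]
          congr 3
          push_cast
          field_simp
        · simp
      · intro m hm
        rw [Function.mem_support] at hm
        have : p ∣ m := by by_contra h; simp [h] at hm
        obtain ⟨a, rfl⟩ := this
        exact ⟨a, rfl⟩
    have hrec : ∑' m : ℕ, (if ∀ q ∈ insert p P, ¬ q ∣ m then ψ m * Φ (m / Y) else 0) =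
        S Y - ψ p * S (Y / p) := by
      rw [hmult, hS, ← Summable.tsum_sub hsm]
      · refine tsum_congr fun m => ?_
        simp only [Finset.forall_mem_insert]
        by_cases h : p ∣ m <;> simp [h]
      · refine hsm.norm.of_norm_bounded fun m => ?_
        split_ifs <;> first | exact le_rfl | (rw [norm_zero]; positivity)
    have hmain : E * Y * ∏ q ∈ insert p P, (1 - 1 / (q : ℂ)) =
        E * Y * ∏ q ∈ P, (1 - 1 / (q : ℂ)) -
          ψ p * (E * ((Y / p : ℝ) : ℂ) * ∏ q ∈ P, (1 - 1 / (q : ℂ))) := by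
      rw [Finset.prod_insert hp]
      rcases hE with rfl | h
      · simp
      · rw [h p hpp]
        push_cast
        ring
    rw [hrec, hmain, Finset.card_insert_of_notMem hp]
    calc _ = ‖(S Y - E * Y * ∏ q ∈ P, (1 - 1 / (q : ℂ))) -
          ψ p * (S (Y / p) - E * ((Y / p : ℝ) : ℂ) * ∏ q ∈ P, (1 - 1 / (q : ℂ)))‖ := by
            congr 1; ring
      _ ≤ 2 ^ P.card * B + 1 * (2 ^ P.card * B) := by
          refine (norm_sub_le _ _).trans (add_le_add i1 ?_)
          rw [norm_mul]
          exact mul_le_mul (hψ p) i2 (norm_nonneg _) zero_le_one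
      _ = _ := by ring

theorem two_pow_card_le (P : Finset ℕ) (hP : ∀ p ∈ P, p.Prime) :
    (2 : ℝ) ^ P.card ≤ 4 * √(∏ p ∈ P, p : ℕ) := by
  have h : ∀ p ∈ P, (2 : ℝ) ≤ (if p < 4 then 2 else 1) * √p := by
    intro p hp
    split_ifs with h
    · have : (1 : ℝ) ≤ √p := Real.one_le_sqrt.2 (by exact_mod_cast (hP p hp).one_le)
      linarith
    · have : (4 : ℝ) ≤ p := by exact_mod_cast not_lt.1 h
      rw [one_mul]
      exact Real.le_sqrt_of_sq_le (by linarith)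
  have h4 : ∏ p ∈ P, (if p < 4 then (2 : ℝ) else 1) ≤ 4 := by
    rw [Finset.prod_ite, Finset.prod_const, Finset.prod_const_one, mul_one]
    have : (P.filter (· < 4)).card ≤ 2 := by
      refine (Finset.card_le_card (t := {2, 3}) fun p hp => ?_).trans (by simp)
      have hpp := hP p (Finset.mem_filter.1 hp).1
      have := hpp.two_le
      have := (Finset.mem_filter.1 hp).2
      simp only [Finset.mem_insert, Finset.mem_singleton]
      omega
    calc (2 : ℝ) ^ _ ≤ 2 ^ 2 := pow_le_pow_right₀ (by norm_num) this
      _ = 4 := by norm_num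
  calc (2 : ℝ) ^ P.card = ∏ p ∈ P, (2 : ℝ) := by simp
    _ ≤ ∏ p ∈ P, ((if p < 4 then (2 : ℝ) else 1) * √p) :=
        Finset.prod_le_prod (fun _ _ => by norm_num) h
    _ = (∏ p ∈ P, (if p < 4 then (2 : ℝ) else 1)) * √(∏ p ∈ P, p : ℕ) := by
        rw [Finset.prod_mul_distrib]
        congr 1
        push_cast
        exact (Real.sqrt_prod P fun p _ => by positivity).symm
    _ ≤ _ := by gcongr

theorem exists_norm_character_sum_sub_le {Φ : ℝ → ℂ} (h1 : HasCompactSupport Φ)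
    (h2 : ContDiff ℝ ∞ Φ) (h3 : ∀ t ≤ 0, Φ t = 0) :
    ∃ C : ℝ, 0 < C ∧ ∀ (N : ℕ) [NeZero N] (χ : DirichletCharacter ℂ N), ∀ Y : ℝ, 0 < Y →
      ‖∑' m : ℕ, χ m * Φ (m / Y) -
        (if χ = 1 then ∫ t, Φ t else 0) * Y * ∏ p ∈ N.primeFactors, (1 - 1 / (p : ℂ))‖ ≤
          C * √N := by
  obtain ⟨C, hC, hprim⟩ := exists_norm_primitive_sum_sub_le h1 h2
  refine ⟨4 * C, by positivity, fun N _ χ Y hY => ?_⟩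
  set f := χ.conductor with hf
  have : NeZero f := ⟨χ.conductor_ne_zero⟩
  have hfN : f ∣ N := χ.conductor_dvd_level
  have hf1 : f = 1 ↔ χ = 1 := χ.eq_one_iff_conductor_eq_one.symm
  set ψ := χ.primitiveCharacter
  have hψ : ψ.IsPrimitive := χ.primitiveCharacter_isPrimitive
  set P := N.primeFactors.filter (fun p => ¬ p ∣ f)
  have hP : ∀ p ∈ P, p.Prime := fun p hp =>
    Nat.prime_of_mem_primeFactors (Finset.mem_filter.1 hp).1
  set E : ℂ := if χ = 1 then ∫ t, Φ t else 0 with hE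
  let Ψ : ℕ →* ℂ := ψ.toMonoidHom.comp (Nat.castRingHom (ZMod f)).toMonoidHom
  have hΨ : ∀ m : ℕ, Ψ m = ψ m := fun _ => rfl
  have hnat : ∀ Y : ℝ, 0 < Y → ∑' m : ℤ, ψ m * Φ (m / Y) = ∑' m : ℕ, Ψ m * Φ (m / Y) := by
    intro Y hY
    rw [← (Nat.cast_injective (R := ℤ)).tsum_eq]
    · simp [hΨ]
    · intro m hm
      by_contra hneg
      have hm0 : m ≤ 0 := by
        by_contra h
        exact hneg ⟨m.toNat, by omega⟩
      refine hm ?_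
      have : (m : ℝ) ≤ 0 := by exact_mod_cast hm0
      simp [h3 (m / Y) (div_nonpos_of_nonpos_of_nonneg this hY.le)]
  have hsumm : ∀ Y : ℝ, 0 < Y → Summable fun m : ℕ => Ψ m * Φ (m / Y) := by
    intro Y hY
    refine summable_of_hasFiniteSupport ?_
    refine Set.Finite.subset ((finite_support_comp_div h1 hY).preimage
      (Nat.cast_injective (R := ℤ)).injOn) fun m hm => ?_
    simpa using right_ne_zero_of_mul hm
  have key := norm_sum_coprime_sub_le (Φ := Φ) (ψ := Ψ) (E := E) (B := C * √f)
    (fun p => ψ.norm_le_one _) ?_ hsumm ?_ P hP Y hY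
  · have hsum : ∑' m : ℕ, χ m * Φ (m / Y) =
        ∑' m : ℕ, (if ∀ p ∈ P, ¬ p ∣ m then Ψ m * Φ (m / Y) else 0) := by
      refine tsum_congr fun m => ?_
      by_cases hco : IsCoprime (m : ℤ) N
      · have h : χ m = ψ m := by
          simpa using (χ.primitiveCharacter_apply_of_isCoprime hco).symm
        rw [if_pos, h, hΨ]
        intro p hp hpm
        rw [Nat.isCoprime_iff_coprime] at hco
        exact Nat.not_coprime_of_dvd_of_dvd (hP p hp).one_lt hpm
          (Nat.dvd_of_mem_primeFactors (Finset.mem_filter.1 hp).1) hco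
      · have h : χ m = 0 := by simpa using (χ.apply_eq_zero_iff m).2 hco
        rw [h, zero_mul]
        split_ifs with hall
        · rw [Nat.isCoprime_iff_coprime, Nat.Prime.not_coprime_iff_dvd] at hco
          obtain ⟨p, hp, hpm, hpN⟩ := hco
          have hpf : p ∣ f := by
            by_contra hpf
            exact hall p (Finset.mem_filter.2
              ⟨Nat.mem_primeFactors.2 ⟨hp, hpN, NeZero.ne N⟩, hpf⟩) hpm
          have : ψ m = 0 := by
            have := (ψ.apply_eq_zero_iff m).2 (by
              rw [Nat.isCoprime_iff_coprime]
              exact Nat.not_coprime_of_dvd_of_dvd hp.one_lt hpm hpf)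
            simpa using this
          rw [hΨ, this, zero_mul]
        · rfl
    have hprod : E * Y * ∏ p ∈ N.primeFactors, (1 - 1 / (p : ℂ)) =
        E * Y * ∏ p ∈ P, (1 - 1 / (p : ℂ)) := by
      by_cases h : χ = 1
      · congr 1
        have : P = N.primeFactors := by
          refine Finset.filter_true_of_mem fun p hp hpf => ?_
          rw [hf1.2 h] at hpf
          exact (Nat.prime_of_mem_primeFactors hp).one_lt.ne' (Nat.dvd_one.1 hpf)
        rw [this]
      · simp [hE, h]
    rw [hsum, hprod]
    refine key.trans ?_
    have hle : (∏ p ∈ P, p) * f ≤ N := by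
      refine Nat.le_of_dvd (NeZero.pos N) (Nat.Coprime.mul_dvd_of_dvd_of_dvd ?_ ?_ hfN)
      · exact Nat.Coprime.prod_left fun p hp =>
          (hP p hp).coprime_iff_not_dvd.2 (Finset.mem_filter.1 hp).2
      · exact (Finset.prod_dvd_prod_of_subset _ _ _ (Finset.filter_subset _ _)).trans
          (Nat.prod_primeFactors_dvd N)
    calc (2 : ℝ) ^ P.card * (C * √f) ≤ 4 * √(∏ p ∈ P, p : ℕ) * (C * √f) := by
          gcongr
          exact two_pow_card_le P hP
      _ = 4 * C * √((∏ p ∈ P, p : ℕ) * f : ℝ) := by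
          rw [Real.sqrt_mul (by positivity)]; ring
      _ ≤ 4 * C * √N := by
          gcongr
          exact_mod_cast hle
  · by_cases h : χ = 1
    · right
      intro p _
      rw [hΨ]
      have hsub : Subsingleton (ZMod f) := by rw [hf1.2 h]; infer_instance
      rw [Subsingleton.elim (p : ZMod f) 1, map_one]
    · left
      simp [hE, h]
  · intro Y hY
    rw [← hnat Y hY]
    convert hprim f ψ hψ Y hY using 3
    by_cases h : χ = 1
    · simp [hE, h, hf1.2 h, mul_comm]
    · simp [hE, h, mt hf1.1 h]

theorem exists_norm_character_sum_sub_le_rpow {Φ : ℝ → ℂ} (h1 : HasCompactSupport Φ)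
    (h2 : ContDiff ℝ ∞ Φ) (h3 : ∀ t ≤ 0, Φ t = 0) {σ : ℝ} (hσ0 : 0 ≤ σ) (hσ1 : σ ≤ 1) :
    ∃ C : ℝ, 0 < C ∧ ∀ (N : ℕ) [NeZero N] (χ : DirichletCharacter ℂ N), ∀ Y : ℝ, 0 < Y →
      ‖∑' m : ℕ, χ m * Φ (m / Y) -
        (if χ = 1 then ∫ t, Φ t else 0) * Y * ∏ p ∈ N.primeFactors, (1 - 1 / (p : ℂ))‖ ≤
          C * Y ^ σ * (N : ℝ) ^ ((1 - σ) / 2) := by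
  obtain ⟨C, hC, hb⟩ := exists_norm_character_sum_sub_le h1 h2 h3
  obtain ⟨R, hR⟩ := h1.isBounded.subset_closedBall 0
  obtain ⟨M, hM⟩ := h2.continuous.bounded_above_of_compact_support h1
  have hM0 : 0 ≤ M := (norm_nonneg _).trans (hM 0)
  set R' := max R 1
  have hR'0 : 0 < R' := by positivity
  set K := C + R' * M + ‖∫ t, Φ t‖
  have hK : 0 < K := by positivity
  refine ⟨K, hK, fun N _ χ Y hY => ?_⟩
  set D := ‖∑' m : ℕ, χ m * Φ (m / Y) -
        (if χ = 1 then ∫ t, Φ t else 0) * Y * ∏ p ∈ N.primeFactors, (1 - 1 / (p : ℂ))‖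
  have hD0 : 0 ≤ D := norm_nonneg _
  have hD1 : D ≤ K * √N := (hb N χ Y hY).trans (by
    gcongr
    have : 0 ≤ R' * M := by positivity
    simp only [K]
    linarith [norm_nonneg (∫ t, Φ t)])
  have hD2 : D ≤ K * Y := by
    have hsum : ‖∑' m : ℕ, χ m * Φ (m / Y)‖ ≤ R' * M * Y := by
      have : ∑' m : ℕ, χ m * Φ (m / Y) = ∑ m ∈ Finset.Icc 1 ⌊R' * Y⌋₊, χ m * Φ (m / Y) := by
        refine tsum_eq_sum fun m hm => ?_
        rw [mul_eq_zero]
        right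
        by_contra hne
        have h0 : 0 < (m / Y : ℝ) := by
          by_contra h
          exact hne (h3 _ (not_lt.1 h))
        have hm0 : (0 : ℝ) < m := by
          have := mul_pos h0 hY
          rwa [div_mul_cancel₀ _ hY.ne'] at this
        have hmem := hR (subset_tsupport _ hne)
        rw [mem_closedBall_zero_iff, Real.norm_eq_abs, abs_of_pos h0, div_le_iff₀ hY] at hmem
        refine hm (Finset.mem_Icc.2 ⟨by exact_mod_cast hm0, Nat.le_floor (hmem.trans ?_)⟩)
        gcongr
        exact le_max_left _ _
      rw [this]
      calc _ ≤ ∑ m ∈ Finset.Icc 1 ⌊R' * Y⌋₊, M := by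
            refine norm_sum_le_of_le _ fun m _ => ?_
            rw [norm_mul]
            calc _ ≤ 1 * M := mul_le_mul (χ.norm_le_one _) (hM _) (norm_nonneg _) zero_le_one
              _ = M := one_mul M
        _ = ⌊R' * Y⌋₊ * M := by simp
        _ ≤ R' * Y * M := by
            gcongr
            exact Nat.floor_le (by positivity)
        _ = _ := by ring
    have hprod : ‖∏ p ∈ N.primeFactors, (1 - 1 / (p : ℂ))‖ ≤ 1 := by
      rw [norm_prod]
      refine Finset.prod_le_one (fun _ _ => norm_nonneg _) fun p hp => ?_
      have hp1 : (1 : ℝ) ≤ p := by exact_mod_cast (Nat.prime_of_mem_primeFactors hp).one_le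
      have : (1 - 1 / (p : ℂ)) = ((1 - 1 / p : ℝ) : ℂ) := by push_cast; rfl
      rw [this, Complex.norm_real, Real.norm_eq_abs, abs_le]
      have h4 : 1 / (p : ℝ) ≤ 1 := by rw [div_le_one (by linarith)]; exact hp1
      have h5 : 0 ≤ 1 / (p : ℝ) := by positivity
      constructor <;> linarith
    have hmain : ‖(if χ = 1 then ∫ t, Φ t else 0) * Y *
        ∏ p ∈ N.primeFactors, (1 - 1 / (p : ℂ))‖ ≤ ‖∫ t, Φ t‖ * Y := by
      rw [norm_mul, norm_mul, Complex.norm_real, Real.norm_of_nonneg hY.le]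
      calc _ ≤ ‖∫ t, Φ t‖ * Y * 1 := by
            gcongr
            split_ifs <;> simp
        _ = _ := mul_one _
    calc D ≤ R' * M * Y + ‖∫ t, Φ t‖ * Y := (norm_sub_le _ _).trans (add_le_add hsum hmain)
      _ = (R' * M + ‖∫ t, Φ t‖) * Y := by ring
      _ ≤ K * Y := by
          gcongr
          simp only [K]
          linarith
  calc D = D ^ σ * D ^ (1 - σ) := by
        rw [← Real.rpow_add' hD0 (by norm_num), add_sub_cancel, Real.rpow_one]
    _ ≤ (K * Y) ^ σ * (K * √N) ^ (1 - σ) := by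
        gcongr
    _ = K * Y ^ σ * (N : ℝ) ^ ((1 - σ) / 2) := by
        rw [Real.mul_rpow hK.le hY.le, Real.mul_rpow hK.le (by positivity), Real.sqrt_eq_rpow,
          ← Real.rpow_mul (by positivity)]
        have : K ^ σ * K ^ (1 - σ) = K := by
          rw [← Real.rpow_add hK, add_sub_cancel, Real.rpow_one]
        calc _ = (K ^ σ * K ^ (1 - σ)) * Y ^ σ * (N : ℝ) ^ (1 / 2 * (1 - σ)) := by ring
          _ = _ := by rw [this]; congr 2; ring

end CharacterSums

theorem summable_of_isMultiplicative_of_pow_eq_zero {F : ℕ → ℝ} (h0 : ∀ n, 0 ≤ F n)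
    (h1 : F 1 = 1) (hmul : ∀ {m n : ℕ}, m.Coprime n → F (m * n) = F m * F n)
    (h3 : ∀ p e : ℕ, p.Prime → 3 ≤ e → F (p ^ e) = 0) {b : ℕ → ℝ} (hb : Summable b)
    (hb0 : ∀ n, 0 ≤ b n) (hF : ∀ p : ℕ, p.Prime → F p + F (p ^ 2) ≤ b p) : Summable F := by
  have hz : ∀ {p : ℕ}, p.Prime → ∀ e ∉ Finset.range 3, F (p ^ e) = 0 := fun {p} hp e he =>
    h3 p e hp (by simpa using he)
  have hs : ∀ {p : ℕ}, p.Prime → Summable fun e : ℕ => ‖F (p ^ e)‖ := fun {p} hp =>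
    summable_of_ne_finset_zero (s := Finset.range 3) fun e he => by rw [hz hp e he, norm_zero]
  have hsmooth : ∀ N : ℕ, ∑' m : N.smoothNumbers, F m ≤ Real.exp (∑' n, b n) := by
    intro N
    rw [(EulerProduct.summable_and_hasSum_smoothNumbers_prod_primesBelow_tsum
      h1 hmul hs N).2.tsum_eq]
    calc ∏ p ∈ N.primesBelow, ∑' e, F (p ^ e) ≤ ∏ p ∈ N.primesBelow, Real.exp (b p) := by
          refine Finset.prod_le_prod (fun p _ => tsum_nonneg fun e => h0 _) fun p hp => ?_
          have hp' := Nat.prime_of_mem_primesBelow hp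
          rw [tsum_eq_sum (hz hp')]
          have := Real.add_one_le_exp (b p)
          have := hF p hp'
          simp only [Finset.sum_range_succ, Finset.range_zero, Finset.sum_empty, pow_zero,
            pow_one, h1]
          linarith
      _ = Real.exp (∑ p ∈ N.primesBelow, b p) := (Real.exp_sum _ _).symm
      _ ≤ _ := Real.exp_le_exp.mpr (hb.sum_le_tsum _ fun n _ => hb0 n)
  refine summable_of_sum_range_le (c := F 0 + Real.exp (∑' n, b n)) h0 fun n => ?_
  rcases n with _ | n
  · simpa using add_nonneg (h0 0) (Real.exp_pos _).le
  rw [Finset.sum_range_succ', add_comm]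
  gcongr
  refine le_trans ?_ (hsmooth (n + 1))
  have hsum : Summable fun m : (n + 1).smoothNumbers => F m :=
    (EulerProduct.summable_and_hasSum_smoothNumbers_prod_primesBelow_tsum
      h1 hmul hs (n + 1)).1.of_norm
  have hmem : ∀ i ∈ Finset.range n, i + 1 ∈ (n + 1).smoothNumbers := fun i hi =>
    Nat.mem_smoothNumbers_of_lt (Nat.succ_pos i) (by simpa using hi)
  have hinj : Function.Injective
      fun i : Finset.range n => (⟨i + 1, hmem i i.2⟩ : (n + 1).smoothNumbers) := by
    intro i j hij
    exact Subtype.ext (Nat.succ_injective (congrArg Subtype.val hij))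
  calc ∑ i ∈ Finset.range n, F (i + 1)
      = ∑ i : Finset.range n, F (i + 1) := (Finset.sum_coe_sort _ fun i => F (i + 1)).symm
    _ = ∑' i : Finset.range n, F (i + 1) := (tsum_fintype _).symm
    _ ≤ _ := (hsum.comp_injective hinj).tsum_le_tsum_of_inj _ hinj (fun c _ => h0 _)
        (fun _ => le_rfl) hsum

theorem A_mul {m n : ℕ} (h : m.Coprime n) : A (m * n) = A m * A n := by
  rw [A, h.primeFactors_mul, Finset.prod_union h.disjoint_primeFactors, A, A]

theorem A_prime {p : ℕ} (hp : p.Prime) : A p = 1 - 1 / (p : ℝ) := by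
  simp [A, hp.primeFactors]

theorem A_pos (n : ℕ) : 0 < A n := by
  refine Finset.prod_pos fun p hp => ?_
  have : (1 : ℝ) < p := by exact_mod_cast (Nat.prime_of_mem_primeFactors hp).one_lt
  rw [sub_pos, div_lt_one (by linarith)]
  exact this

/-- The function `A(d)^{-k}` restricted to squarefree `d`. -/
noncomputable def squarefreeWeight (k : ℝ) : ArithmeticFunction ℝ :=
  ⟨fun d => if Squarefree d then A d ^ (-k) else 0, by simp⟩

theorem squarefreeWeight_apply (k : ℝ) (d : ℕ) :
    squarefreeWeight k d = if Squarefree d then A d ^ (-k) else 0 := rfl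

theorem isMultiplicative_squarefreeWeight (k : ℝ) : (squarefreeWeight k).IsMultiplicative := by
  refine ⟨by simp [squarefreeWeight_apply, A], fun {m n} h => ?_⟩
  simp only [squarefreeWeight_apply, Nat.squarefree_mul_iff, A_mul h,
    Real.mul_rpow (A_pos m).le (A_pos n).le]
  by_cases hm : Squarefree m <;> by_cases hn : Squarefree n <;> simp [hm, hn, h.gcd_eq_one]

/-- The Möbius inverse of `squarefreeWeight`. -/
noncomputable def squarefreeCoeff (k : ℝ) : ArithmeticFunction ℝ :=
  (ArithmeticFunction.moebius : ArithmeticFunction ℝ) * squarefreeWeight k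

theorem isMultiplicative_squarefreeCoeff (k : ℝ) : (squarefreeCoeff k).IsMultiplicative :=
  (ArithmeticFunction.isMultiplicative_moebius.intCast).mul (isMultiplicative_squarefreeWeight k)

theorem sum_divisors_squarefreeCoeff (k : ℝ) (d : ℕ) :
    ∑ c ∈ d.divisors, squarefreeCoeff k c = squarefreeWeight k d := by
  rw [← ArithmeticFunction.coe_zeta_mul_apply, squarefreeCoeff, ← mul_assoc,
    ArithmeticFunction.coe_zeta_mul_coe_moebius, one_mul]

theorem squarefreeCoeff_prime_pow_succ (k : ℝ) {p : ℕ} (hp : p.Prime) (e : ℕ) :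
    squarefreeCoeff k (p ^ (e + 1)) =
      squarefreeWeight k (p ^ (e + 1)) - squarefreeWeight k (p ^ e) := by
  rw [← sum_divisors_squarefreeCoeff, ← sum_divisors_squarefreeCoeff,
    Nat.sum_divisors_prime_pow hp, Nat.sum_divisors_prime_pow hp, Finset.sum_range_succ _ (e + 1)]
  ring

theorem squarefreeCoeff_prime (k : ℝ) {p : ℕ} (hp : p.Prime) :
    squarefreeCoeff k p = A p ^ (-k) - 1 := by
  have := squarefreeCoeff_prime_pow_succ k hp 0
  simpa [squarefreeWeight_apply, hp.squarefree, A] using this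

theorem not_squarefree_prime_pow {p : ℕ} (hp : p.Prime) (e : ℕ) :
    ¬ Squarefree (p ^ (e + 2)) := by
  rw [Nat.squarefree_pow_iff hp.ne_one (by lia)]
  lia

theorem squarefreeCoeff_prime_sq (k : ℝ) {p : ℕ} (hp : p.Prime) :
    squarefreeCoeff k (p ^ 2) = - A p ^ (-k) := by
  have := squarefreeCoeff_prime_pow_succ k hp 1
  have h2 := not_squarefree_prime_pow hp 0
  simp only [squarefreeWeight_apply, pow_one, hp.squarefree, if_true] at this
  simpa [h2] using this

theorem squarefreeCoeff_prime_pow (k : ℝ) {p : ℕ} (hp : p.Prime) {e : ℕ} (he : 3 ≤ e) :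
    squarefreeCoeff k (p ^ e) = 0 := by
  obtain ⟨e, rfl⟩ := Nat.exists_eq_add_of_le' he
  have := squarefreeCoeff_prime_pow_succ k hp (e + 2)
  simpa [squarefreeWeight_apply, not_squarefree_prime_pow hp,
    show e + 2 + 1 = (e + 1) + 2 by ring] using this

theorem A_rpow_neg_bounds {k : ℝ} (hk : 0 ≤ k) {p : ℕ} (hp : p.Prime) :
    1 ≤ A p ^ (-k) ∧ A p ^ (-k) ≤ Real.exp (2 * k) ∧
      A p ^ (-k) - 1 ≤ 2 * k * Real.exp (2 * k) / p := by
  have h2 : (2 : ℝ) ≤ p := by exact_mod_cast hp.two_le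
  have hp0 : (0 : ℝ) < p := by linarith
  have hA := A_prime hp
  have hA0 := A_pos p
  have hinv : (A p)⁻¹ ≤ 1 + 2 / p := by
    rw [inv_le_iff_one_le_mul₀ hA0, hA]
    field_simp
    nlinarith
  have hle : A p ^ (-k) ≤ Real.exp (2 * k / p) := by
    rw [Real.rpow_neg hA0.le, ← Real.inv_rpow hA0.le]
    calc (A p)⁻¹ ^ k ≤ (Real.exp (2 / p)) ^ k := by
          refine Real.rpow_le_rpow (by positivity) ?_ hk
          linarith [Real.add_one_le_exp (2 / (p : ℝ))]
      _ = _ := by rw [← Real.exp_mul]; congr 1; ring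
  have hkp : 2 * k / p ≤ 2 * k := div_le_self (by positivity) (by linarith)
  refine ⟨?_, hle.trans (Real.exp_le_exp.mpr hkp), ?_⟩
  · refine Real.one_le_rpow_of_pos_of_le_one_of_nonpos hA0 ?_ (by linarith)
    rw [hA]
    have : 0 ≤ 1 / (p : ℝ) := by positivity
    linarith
  · have h := Real.add_one_le_exp (-(2 * k / p))
    have he := Real.exp_pos (2 * k / p)
    have hmul : Real.exp (2 * k / p) * Real.exp (-(2 * k / p)) = 1 := by
      rw [← Real.exp_add]; simp
    have : Real.exp (2 * k / p) - 1 ≤ 2 * k / p * Real.exp (2 * k / p) := by nlinarith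
    calc A p ^ (-k) - 1 ≤ 2 * k / p * Real.exp (2 * k / p) := by linarith
      _ ≤ 2 * k / p * Real.exp (2 * k) := by gcongr
      _ = _ := by ring

theorem summable_abs_squarefreeCoeff {k : ℝ} (hk : 0 ≤ k) {σ : ℝ} (hσ : 1 / 2 < σ) :
    Summable fun c : ℕ => |squarefreeCoeff k c| * (c : ℝ) ^ (-σ) := by
  have hm := isMultiplicative_squarefreeCoeff k
  have hb : Summable fun n : ℕ => 2 * k * Real.exp (2 * k) * (n : ℝ) ^ (-(1 + σ)) +
      Real.exp (2 * k) * (n : ℝ) ^ (-(2 * σ)) :=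
    ((Real.summable_nat_rpow.mpr (by linarith)).mul_left _).add
      ((Real.summable_nat_rpow.mpr (by linarith)).mul_left _)
  refine summable_of_isMultiplicative_of_pow_eq_zero (fun n => by positivity) (by simp [hm.1])
    (fun {m n} h => ?_) (fun p e hp he => ?_) hb (fun n => by positivity) fun p hp => ?_
  · rw [hm.2 h, abs_mul, Nat.cast_mul, Real.mul_rpow (by positivity) (by positivity)]
    ring
  · simp [squarefreeCoeff_prime_pow k hp he]
  · obtain ⟨h1, h2, h3⟩ := A_rpow_neg_bounds hk hp
    have hp0 : (0 : ℝ) < p := by exact_mod_cast hp.pos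
    rw [squarefreeCoeff_prime k hp, squarefreeCoeff_prime_sq k hp, abs_neg,
      abs_of_nonneg (by linarith), abs_of_nonneg (by linarith)]
    have e1 : (p : ℝ) ^ (-(1 + σ)) = (p : ℝ) ^ (-σ) / p := by
      rw [neg_add, add_comm, Real.rpow_add hp0, Real.rpow_neg_one]; rfl
    have e2 : ((p ^ 2 : ℕ) : ℝ) ^ (-σ) = (p : ℝ) ^ (-(2 * σ)) := by
      rw [Nat.cast_pow, ← Real.rpow_natCast, ← Real.rpow_mul hp0.le]
      congr 1; push_cast; ring
    rw [e1, e2]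
    refine add_le_add ?_ (by gcongr)
    calc _ ≤ 2 * k * Real.exp (2 * k) / p * (p : ℝ) ^ (-σ) := by gcongr
      _ = _ := by ring

theorem hasProd_coprime_squarefreeCoeff {k : ℝ} (hk : 0 ≤ k) (N : ℕ) :
    HasProd (Set.mulIndicator {p : ℕ | p.Prime ∧ ¬ p ∣ N}
        fun p => (1 - 1 / (p : ℝ)) * (1 + A p ^ (-k) / p))
      (∑' c : ℕ, if c.Coprime N then squarefreeCoeff k c / c else 0) := by
  have hm := isMultiplicative_squarefreeCoeff k
  set F : ℕ → ℝ := fun c => if c.Coprime N then squarefreeCoeff k c / c else 0 with hF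
  have hsum : Summable fun c => ‖F c‖ := by
    refine (summable_abs_squarefreeCoeff hk (by norm_num : (1 : ℝ) / 2 < 1)).of_nonneg_of_le
      (fun _ => norm_nonneg _) fun c => ?_
    simp only [hF, Real.rpow_neg_one]
    split_ifs
    · rw [norm_div, Real.norm_eq_abs, Real.norm_natCast, div_eq_mul_inv]
    · rw [norm_zero]; positivity
  have hmul : ∀ {m n : ℕ}, m.Coprime n → F (m * n) = F m * F n := by
    intro m n h
    simp only [hF, Nat.coprime_mul_iff_left, hm.2 h, Nat.cast_mul]
    by_cases h1 : m.Coprime N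
    · by_cases h2 : n.Coprime N
      · rw [if_pos ⟨h1, h2⟩, if_pos h1, if_pos h2, mul_div_mul_comm]
      · rw [if_neg fun h => h2 h.2, if_neg h2, mul_zero]
    · rw [if_neg fun h => h1 h.1, if_neg h1, zero_mul]
  have key := EulerProduct.eulerProduct_hasProd_mulIndicator (f := F) (by simp [hF, hm.1]) hmul
    hsum (by simp [hF])
  refine (congrArg (HasProd · _) (funext fun p => ?_)).mpr key
  by_cases hp : p.Prime
  swap
  · simp [Set.mulIndicator, hp]
  rw [Set.mulIndicator_of_mem (s := {p | Nat.Prime p}) hp]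
  have hp0 : (p : ℝ) ≠ 0 := by exact_mod_cast hp.ne_zero
  by_cases hpN : p ∣ N
  · rw [Set.mulIndicator_of_notMem (by simp [hpN]), tsum_eq_single 0 fun e he => ?_]
    · simp [hF, hm.1]
    · simp only [hF]
      rw [if_neg]
      rw [Nat.coprime_pow_left_iff (Nat.pos_of_ne_zero he), hp.coprime_iff_not_dvd]
      exact not_not_intro hpN
  · rw [Set.mulIndicator_of_mem (by exact ⟨hp, hpN⟩), tsum_eq_sum (s := Finset.range 3)]
    · have hc : ∀ e, F (p ^ e) = squarefreeCoeff k (p ^ e) / (p ^ e : ℕ) := fun e =>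
        if_pos (((hp.coprime_iff_not_dvd).mpr hpN).pow_left e)
      simp only [hc, Finset.sum_range_succ, Finset.range_zero, Finset.sum_empty,
        pow_zero, pow_one, hm.1, squarefreeCoeff_prime k hp, squarefreeCoeff_prime_sq k hp]
      push_cast
      field_simp
      ring
    · intro e he
      simp [hF, squarefreeCoeff_prime_pow k hp (e := e) (by simpa using he)]

theorem prod_mul_tsum_coprime_squarefreeCoeff {k : ℝ} (hk : 0 ≤ k) {n : ℕ} (hn : Odd n) :
    (∏ p ∈ (2 * n).primeFactors, (1 - 1 / (p : ℝ))) *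
        ∑' c : ℕ, (if c.Coprime (2 * n) then squarefreeCoeff k c / c else 0) =
      1 / 2 * (∏ p ∈ n.primeFactors, (1 + A p ^ (-k) / (p : ℝ))⁻¹) *
        ∏' p : {p : ℕ // p.Prime ∧ p ≠ 2},
          (1 - 1 / ((p : ℕ) : ℝ)) * (1 + A (p : ℕ) ^ (-k) / ((p : ℕ) : ℝ)) := by
  set w : ℕ → ℝ := fun p => (1 - 1 / (p : ℝ)) * (1 + A p ^ (-k) / p) with hw
  have hprod : ∏' p : {p : ℕ // p.Prime ∧ p ≠ 2}, w p =
      ∏' p, Set.mulIndicator {p : ℕ | p.Prime ∧ p ≠ 2} w p :=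
    tprod_subtype {p : ℕ | p.Prime ∧ p ≠ 2} w
  have h1 := hasProd_coprime_squarefreeCoeff hk (2 * n)
  have h2 : HasProd (fun p => if p ∈ n.primeFactors then w p else 1)
      (∏ p ∈ n.primeFactors, w p) := by
    have := hasProd_prod_of_ne_finset_one (L := SummationFilter.unconditional ℕ)
      (f := fun p => if p ∈ n.primeFactors then w p else 1)
      (s := n.primeFactors) (fun p hp => if_neg hp)
    rwa [Finset.prod_congr rfl fun p hp => if_pos hp] at this
  have h3 := h1.mul h2
  have heq : (fun p => Set.mulIndicator {p : ℕ | p.Prime ∧ ¬ p ∣ 2 * n} w p *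
      (if p ∈ n.primeFactors then w p else 1)) =
      Set.mulIndicator {p : ℕ | p.Prime ∧ p ≠ 2} w := by
    ext p
    have hn0 : n ≠ 0 := by rintro rfl; simp at hn
    by_cases hp : p.Prime
    swap
    · simp [Set.mulIndicator, hp]
    by_cases hp2 : p = 2
    · subst hp2
      have : ¬ 2 ∣ n := fun h => (Nat.not_even_iff_odd.mpr hn) (even_iff_two_dvd.mpr h)
      simp [Set.mulIndicator, this]
    · have : p ∣ 2 * n ↔ p ∣ n := by
        rw [hp.dvd_mul, Nat.prime_dvd_prime_iff_eq hp Nat.prime_two]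
        simp [hp2]
      by_cases hpn : p ∣ n <;> simp [Set.mulIndicator, hp, hp2, this, hpn, hn0]
  rw [heq] at h3
  rw [hprod, h3.tprod_eq, Nat.Coprime.primeFactors_mul (by simpa using hn),
    Finset.prod_union (Nat.Coprime.disjoint_primeFactors (by simpa using hn)),
    Nat.prime_two.primeFactors, Finset.prod_singleton, hw, Finset.prod_mul_distrib,
    Finset.prod_inv_distrib]
  have : ∏ p ∈ n.primeFactors, (1 + A p ^ (-k) / (p : ℝ)) ≠ 0 := by
    refine Finset.prod_ne_zero_iff.mpr fun p _ => ?_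
    have := Real.rpow_pos_of_pos (A_pos p) (-k)
    positivity
  field_simp
  push_cast
  ring

theorem exists_coprime_jacobiSym_eq_neg_one {n : ℕ} (hn : Odd n) (hsq : ¬ IsSquare n) :
    ∃ x : ℕ, x.Coprime n ∧ jacobiSym x n = -1 := by
  obtain ⟨a, b, hab, ha⟩ := Nat.sq_mul_squarefree n
  have hn0 : n ≠ 0 := by rintro rfl; simp at hn
  have ha1 : a ≠ 1 := fun h => hsq ⟨b, by rw [← hab, h]; ring⟩
  obtain ⟨p, hp, c, rfl⟩ := Nat.exists_prime_and_dvd ha1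
  have : Fact p.Prime := ⟨hp⟩
  have hpn : p ∣ n := hab ▸ Dvd.intro (b ^ 2 * c) (by ring)
  have hp2 : p ≠ 2 := by
    rintro rfl
    exact Nat.not_even_iff_odd.mpr hn (even_iff_two_dvd.mpr hpn)
  have hpc : p.Coprime c := Nat.coprime_of_squarefree_mul ha
  obtain ⟨e, m, hpm, hem⟩ := Nat.exists_eq_pow_mul_and_not_dvd hn0 p hp.ne_one
  have hpm' : p.Coprime m := hp.coprime_iff_not_dvd.mpr hpm
  have hcm : c ∣ m := by
    refine (hpc.symm.pow_right e).dvd_of_dvd_mul_left ?_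
    rw [← hem, ← hab]
    exact Dvd.intro_left (b ^ 2 * p) (by ring)
  obtain ⟨u, hu⟩ := FiniteField.exists_nonsquare (F := ZMod p) (by rwa [ZMod.ringChar_zmod_n])
  obtain ⟨x, hxp, hxm⟩ := Nat.chineseRemainder hpm' u.val 1
  have hxu : ((x : ℤ) : ZMod p) = u := by
    have := (ZMod.natCast_eq_natCast_iff _ _ _).mpr hxp
    simpa using this
  have hJp : jacobiSym x p = -1 := by
    rw [← jacobiSym.legendreSym.to_jacobiSym, legendreSym.eq_neg_one_iff, hxu]
    exact hu
  have hxpc : x.Coprime p := by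
    rw [Nat.coprime_comm, hp.coprime_iff_not_dvd, ← ZMod.natCast_eq_zero_iff]
    intro h
    rw [Int.cast_natCast, h] at hxu
    exact hu (hxu ▸ IsSquare.zero)
  have hxmc : x.Coprime m := by
    rw [Nat.Coprime, hxm.gcd_eq, Nat.gcd_one_left]
  have hxn : x.Coprime n := hem ▸ (hxpc.pow_right e).mul_right hxmc
  refine ⟨x, hxn, ?_⟩
  have hb0 : b ≠ 0 := by rintro rfl; simp at hab; exact hn0 hab.symm
  have hc0 : c ≠ 0 := by rintro rfl; simp at hab; exact hn0 hab.symm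
  have hxb : (x : ℤ).gcd b = 1 := by
    rw [Int.gcd_natCast_natCast]
    exact hxn.coprime_dvd_right (hab ▸ Dvd.intro (b * (p * c)) (by ring))
  have hJc : jacobiSym x c = 1 := by
    rw [jacobiSym.mod_left' (a₂ := 1), jacobiSym.one_left]
    exact_mod_cast hxm.of_dvd hcm
  rw [← hab, jacobiSym.mul_right' _ (pow_ne_zero 2 hb0) (mul_ne_zero hp.ne_zero hc0),
    jacobiSym.mul_right' _ hp.ne_zero hc0, jacobiSym.pow_right, jacobiSym.sq_one hxb, hJp, hJc]
  norm_num

theorem jacobiSym_of_isSquare {n : ℕ} (hsq : IsSquare n) {x : ℤ} (hx : x.gcd n = 1) :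
    jacobiSym x n = 1 := by
  obtain ⟨b, rfl⟩ := hsq
  rw [← sq, jacobiSym.pow_right, jacobiSym.sq_one]
  refine Nat.Coprime.coprime_dvd_right (Dvd.intro b rfl) ?_
  exact hx

/-- The Jacobi symbol `(· / n)` as a Dirichlet character modulo `n`. -/
noncomputable def jacobiChar (n : ℕ) [NeZero n] : DirichletCharacter ℂ n where
  toFun x := (jacobiSym x.val n : ℂ)
  map_one' := by
    have := jacobiSym.mod_left' (a₁ := ((1 : ZMod n).val : ℤ)) (a₂ := 1) (b := n) (by
      rw [ZMod.val_one_eq_one_mod]; simp)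
    rw [this, jacobiSym.one_left, Int.cast_one]
  map_mul' x y := by
    rw [ZMod.val_mul, Int.natCast_mod, ← jacobiSym.mod_left, Nat.cast_mul, jacobiSym.mul_left,
      Int.cast_mul]
  map_nonunit' x hx := by
    rw [← ZMod.natCast_zmod_val x, ZMod.isUnit_iff_coprime] at hx
    rw [Int.cast_eq_zero, jacobiSym.eq_zero_iff_not_coprime, Int.gcd_natCast_natCast]
    exact hx

theorem jacobiChar_natCast (n : ℕ) [NeZero n] (d : ℕ) :
    jacobiChar n (d : ZMod n) = (jacobiSym d n : ℂ) := by
  change ((jacobiSym ((d : ZMod n).val : ℤ) n : ℤ) : ℂ) = _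
  rw [ZMod.val_natCast, Int.natCast_mod, ← jacobiSym.mod_left]

theorem jacobiChar_eq_one_iff {n : ℕ} [NeZero n] (hn : Odd n) :
    jacobiChar n = 1 ↔ IsSquare n := by
  constructor
  · intro h
    by_contra hsq
    obtain ⟨x, hx, hJ⟩ := exists_coprime_jacobiSym_eq_neg_one hn hsq
    have h1 := jacobiChar_natCast n x
    rw [h, hJ, MulChar.one_apply ((ZMod.isUnit_iff_coprime x n).mpr hx)] at h1
    norm_num at h1
  · intro hsq
    refine MulChar.ext fun u => ?_
    have hu := (ZMod.isUnit_iff_coprime (u : ZMod n).val n).mp (by simp)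
    rw [← ZMod.natCast_zmod_val (u : ZMod n), jacobiChar_natCast,
      jacobiSym_of_isSquare hsq (by rwa [Int.gcd_natCast_natCast]),
      MulChar.one_apply (by simp)]
    simp

/-- The Jacobi symbol `(· / n)`, made to vanish on even arguments. -/
noncomputable def oddJacobiChar (n : ℕ) [NeZero n] : DirichletCharacter ℂ (2 * n) :=
  DirichletCharacter.changeLevel (dvd_mul_left n 2) (jacobiChar n)

theorem oddJacobiChar_eq_one_iff {n : ℕ} [NeZero n] (hn : Odd n) :
    oddJacobiChar n = 1 ↔ IsSquare n := by
  rw [oddJacobiChar, DirichletCharacter.changeLevel_eq_one_iff, jacobiChar_eq_one_iff hn]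

theorem oddJacobiChar_natCast (n : ℕ) [NeZero n] (d : ℕ) :
    oddJacobiChar n (d : ZMod (2 * n)) = if Odd d then (jacobiSym d n : ℂ) else 0 := by
  by_cases h : d.Coprime (2 * n)
  · have hu := (ZMod.isUnit_iff_coprime d (2 * n)).mpr h
    have hodd : Odd d := (Nat.coprime_mul_iff_right.mp h).1.odd_of_right
    rw [if_pos hodd, ← jacobiChar_natCast, oddJacobiChar, ← hu.unit_spec,
      DirichletCharacter.changeLevel_eq_cast_of_dvd, hu.unit_spec, ZMod.cast_natCast (dvd_mul_left n 2)]
  · rw [MulChar.map_nonunit _ (by rwa [ZMod.isUnit_iff_coprime])]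
    split_ifs with hodd
    · have : ¬ d.Coprime n := fun h' => h (Nat.Coprime.mul_right (by simpa using hodd) h')
      rw [eq_comm, Int.cast_eq_zero, jacobiSym.eq_zero_iff_not_coprime,
        Int.gcd_natCast_natCast]
      exact this
    · rfl

theorem chi8_eq {n : ℕ} (hn : Odd n) (d : ℕ) :
    chi8 d n = jacobiSym 8 n * jacobiSym d n := by
  rw [chi8, if_pos (Nat.odd_iff.mp hn), jacobiSym.mul_left]

theorem tsum_mul_sum_divisors {w g : ℕ → ℂ} (h0 : w 0 = 0) {D : ℕ} (hD : ∀ d, D < d → w d = 0) :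
    ∑' d, (∑ c ∈ d.divisors, g c) * w d = ∑' c, g c * ∑' m, w (c * m) := by
  have hw : ∀ d ∉ Finset.Ioc 0 D, w d = 0 := by
    intro d hd
    rw [Finset.mem_Ioc, not_and_or, not_lt, not_le, Nat.le_zero] at hd
    rcases hd with rfl | hd
    exacts [h0, hD d hd]
  rw [tsum_eq_sum (s := Finset.Ioc 0 D) fun d hd => by rw [hw d hd, mul_zero],
    tsum_eq_sum (s := Finset.Ioc 0 D)]
  · have hL : ∀ d ∈ Finset.Ioc 0 D, (∑ c ∈ d.divisors, g c) * w d =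
        ∑ c ∈ Finset.Ioc 0 D, if c ∣ d then g c * w d else 0 := by
      intro d hd
      rw [Finset.mem_Ioc] at hd
      rw [← Finset.sum_filter, Finset.sum_mul]
      refine Finset.sum_congr (Finset.ext fun c => ?_) fun _ _ => rfl
      simp only [Nat.mem_divisors, Finset.mem_filter, Finset.mem_Ioc]
      exact ⟨fun h => ⟨⟨Nat.pos_of_dvd_of_pos h.1 hd.1, (Nat.le_of_dvd hd.1 h.1).trans hd.2⟩, h.1⟩,
        fun h => ⟨h.2, hd.1.ne'⟩⟩
    rw [Finset.sum_congr rfl hL, Finset.sum_comm]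
    refine Finset.sum_congr rfl fun c hc => ?_
    have hc0 : 0 < c := (Finset.mem_Ioc.mp hc).1
    have hinj : Function.Injective (c * ·) := fun _ _ h => Nat.eq_of_mul_eq_mul_left hc0 h
    have := hinj.tsum_eq (f := fun d => if c ∣ d then w d else 0) (by
      intro d hd
      simp only [Function.mem_support, ne_eq, ite_eq_right_iff, Classical.not_imp] at hd
      obtain ⟨m, rfl⟩ := hd.1
      exact ⟨m, rfl⟩)
    simp only [dvd_mul_right, if_true] at this
    rw [this, tsum_eq_sum (s := Finset.Ioc 0 D) fun d hd => by rw [hw d hd, ite_self],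
      Finset.mul_sum]
    exact Finset.sum_congr rfl fun d _ => by rw [mul_ite, mul_zero]
  · intro c hc
    rw [Finset.mem_Ioc, not_and_or, not_lt, not_le, Nat.le_zero] at hc
    rw [tsum_congr (g := 0) fun m => ?_, Pi.zero_def, tsum_zero, mul_zero]
    rcases hc with rfl | hc
    · simpa using h0
    rcases Nat.eq_zero_or_pos m with rfl | hm
    · simpa using h0
    · exact hD _ (hc.trans_le (Nat.le_mul_of_pos_right c hm))

open scoped ContDiff in
theorem exists_norm_squarefree_character_sum_sub_le {Φ : ℝ → ℂ} (h1 : HasCompactSupport Φ)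
    (h2 : ContDiff ℝ ∞ Φ) (h3 : ∀ t ≤ 0, Φ t = 0) {k : ℝ} (hk : 0 ≤ k) {σ : ℝ}
    (hσ0 : 1 / 2 < σ) (hσ1 : σ ≤ 1) :
    ∃ C, 0 < C ∧ ∀ (N : ℕ) [NeZero N] (χ : DirichletCharacter ℂ N), ∀ X : ℝ, 0 < X →
      ‖∑' d : ℕ, (squarefreeWeight k d : ℂ) * (χ d * Φ (d / X)) -
          (if χ = 1 then ∫ t, Φ t else 0) * X *
            (((∏ p ∈ N.primeFactors, (1 - 1 / (p : ℝ))) *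
              ∑' c : ℕ, (if c.Coprime N then squarefreeCoeff k c / c else 0) : ℝ) : ℂ)‖ ≤
        C * X ^ σ * (N : ℝ) ^ ((1 - σ) / 2) := by
  obtain ⟨C, hC, hbound⟩ := exists_norm_character_sum_sub_le_rpow h1 h2 h3
    (by linarith : 0 ≤ σ) hσ1
  have hK := summable_abs_squarefreeCoeff hk hσ0
  have hK1 := summable_abs_squarefreeCoeff hk (by norm_num : (1 : ℝ) / 2 < 1)
  set K := ∑' c : ℕ, |squarefreeCoeff k c| * (c : ℝ) ^ (-σ) with hKdef
  have hK0 : 0 ≤ K := tsum_nonneg fun c => by positivity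
  refine ⟨C * (K + 1), by positivity, fun N _ χ X hX => ?_⟩
  set I : ℂ := if χ = 1 then ∫ t, Φ t else 0 with hI
  set P : ℂ := ∏ p ∈ N.primeFactors, (1 - 1 / (p : ℂ)) with hP
  set S : ℕ → ℂ := fun c => ∑' m : ℕ, χ m * Φ (m / (X / c)) with hS
  set main : ℕ → ℂ := fun c => squarefreeCoeff k c * (χ c * (I * (X / c : ℝ) * P)) with hmain
  set err : ℕ → ℂ := fun c =>
    squarefreeCoeff k c * (χ c * (S c - I * (X / c : ℝ) * P)) with herr
  have hχ : ∀ c : ℕ, ‖χ c‖ ≤ 1 := fun c => χ.norm_le_one _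
  have herr_le : ∀ c, ‖err c‖ ≤ C * X ^ σ * (N : ℝ) ^ ((1 - σ) / 2) *
      (|squarefreeCoeff k c| * (c : ℝ) ^ (-σ)) := by
    intro c
    rcases Nat.eq_zero_or_pos c with rfl | hc
    · simp [herr]
    have hc' : (0 : ℝ) < c := by exact_mod_cast hc
    have := hbound N χ (X / c) (by positivity)
    rw [Real.div_rpow hX.le hc'.le] at this
    calc ‖err c‖ = |squarefreeCoeff k c| * (‖χ c‖ * ‖S c - I * (X / c : ℝ) * P‖) := by
          rw [herr, norm_mul, norm_mul, Complex.norm_real, Real.norm_eq_abs]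
      _ ≤ |squarefreeCoeff k c| *
          (1 * (C * (X ^ σ / (c : ℝ) ^ σ) * (N : ℝ) ^ ((1 - σ) / 2))) := by
          gcongr
          exact hχ c
      _ = _ := by rw [Real.rpow_neg hc'.le]; ring
  have herr_sum : Summable err := (hK.mul_left _).of_norm_bounded herr_le
  have hmain_sum : Summable main := by
    refine (hK1.mul_left ‖I * X * P‖).of_norm_bounded fun c => ?_
    calc ‖main c‖ = ‖I * X * P‖ * (|squarefreeCoeff k c| * (c : ℝ) ^ (-(1 : ℝ))) * ‖χ c‖ := by
          rw [hmain, Real.rpow_neg_one]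
          push_cast
          simp only [norm_mul, norm_div, Complex.norm_real, Real.norm_eq_abs, Complex.norm_natCast]
          ring
      _ ≤ _ := mul_le_of_le_one_right (by positivity) (hχ c)
  have hmain_eq : ∑' c, main c = I * X * (((∏ p ∈ N.primeFactors, (1 - 1 / (p : ℝ))) *
      ∑' c : ℕ, (if c.Coprime N then squarefreeCoeff k c / c else 0) : ℝ) : ℂ) := by
    rw [Complex.ofReal_mul, Complex.ofReal_tsum, ← mul_assoc, ← tsum_mul_left]
    refine tsum_congr fun c => ?_
    have hPr : ((∏ p ∈ N.primeFactors, (1 - 1 / (p : ℝ)) : ℝ) : ℂ) = P := by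
      rw [hP]; push_cast; rfl
    rw [hPr, hmain]
    by_cases h : χ = 1
    · subst h
      by_cases hc : c.Coprime N
      · rw [if_pos hc]
        simp only [MulChar.one_apply ((ZMod.isUnit_iff_coprime c N).mpr hc)]
        push_cast
        ring
      · rw [if_neg hc]
        simp only [MulChar.map_nonunit _ (mt (ZMod.isUnit_iff_coprime c N).mp hc)]
        simp
    · simp [hI, h]
  have hsum : ∑' d : ℕ, (squarefreeWeight k d : ℂ) * (χ d * Φ (d / X)) =
      ∑' c, err c + ∑' c, main c := by
    rw [← herr_sum.tsum_add hmain_sum]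
    obtain ⟨R, hR⟩ := h1.isBounded.subset_closedBall 0
    have hswap := tsum_mul_sum_divisors (w := fun d : ℕ => χ d * Φ (d / X))
      (g := fun c => (squarefreeCoeff k c : ℂ)) (by simp [h3]) (D := ⌈R * X⌉₊) (fun d hd => by
        have : Φ (d / X) = 0 := by
          by_contra h
          have h' := hR (subset_tsupport _ h)
          rw [mem_closedBall_zero_iff, Real.norm_eq_abs, abs_of_nonneg (by positivity),
            div_le_iff₀ hX] at h'
          exact absurd (Nat.lt_of_ceil_lt hd) (not_lt.mpr h')
        simp only [this, mul_zero])
    rw [tsum_congr fun d => by rw [← sum_divisors_squarefreeCoeff, Complex.ofReal_sum], hswap]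
    refine tsum_congr fun c => ?_
    have hSc : ∑' m : ℕ, χ ((c * m : ℕ) : ZMod N) * Φ ((c * m : ℕ) / X) = χ c * S c := by
      rw [hS, ← tsum_mul_left]
      refine tsum_congr fun m => ?_
      rw [Nat.cast_mul, Nat.cast_mul, map_mul, mul_assoc, div_div_eq_mul_div, mul_comm (m : ℝ)]
    rw [hSc, herr, hmain]
    ring
  rw [hsum, hmain_eq, add_sub_cancel_right]
  have hN : (0 : ℝ) ≤ (N : ℝ) ^ ((1 - σ) / 2) := by positivity
  calc ‖∑' c, err c‖ ≤ C * X ^ σ * (N : ℝ) ^ ((1 - σ) / 2) * K :=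
        tsum_of_norm_bounded (hK.hasSum.mul_left _) herr_le
    _ ≤ C * X ^ σ * (N : ℝ) ^ ((1 - σ) / 2) * (K + 1) := by gcongr; linarith
    _ = _ := by ring

/-- For a non-negative smooth `Φ` compactly supported in the positive reals and `k ≥ 0`,
for odd positive `n` the smoothed sum `∑_{d odd squarefree} A(d)^{-k} χ^{(8d)}(n) Φ(d/X)`
equals a main term (present only when `n` is a perfect square) involving
`Φ̂(1) = ∫₀^∞ Φ(t) dt`, up to an error `O_{k,ε,Φ}(X^{1/2+ε} n^{1/4+ε})`. -/
theorem stmt_5 (Φ : ℝ → ℝ) (hΦsmooth : ContDiff ℝ (⊤ : ℕ∞) Φ) (hΦnonneg : ∀ t, 0 ≤ Φ t)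
    (hΦcompact : HasCompactSupport Φ) (hΦsupp : tsupport Φ ⊆ Set.Ioi 0)
    (k : ℝ) (hk : 0 ≤ k) (ε : ℝ) (hε : 0 < ε) :
    ∃ C : ℝ, 0 < C ∧
      ∀ X : ℝ, 1 ≤ X → ∀ n : ℕ, 0 < n → Odd n →
        |(∑' d : ℕ, (if Odd d ∧ Squarefree d then
              A d ^ (-k) * (chi8 d n : ℝ) * Φ ((d : ℝ) / X) else 0)) -
            (if IsSquare n then (1 : ℝ) else 0) * (∫ t in Set.Ioi (0 : ℝ), Φ t) * (X / 2) *
              (∏ p ∈ n.primeFactors, (1 + A p ^ (-k) / (p : ℝ))⁻¹) *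
              (∏' p : {p : ℕ // p.Prime ∧ p ≠ 2},
                (1 - 1 / ((p : ℕ) : ℝ)) * (1 + A (p : ℕ) ^ (-k) / ((p : ℕ) : ℝ)))|
          ≤ C * X ^ ((1 : ℝ) / 2 + ε) * (n : ℝ) ^ ((1 : ℝ) / 4 + ε) := by
  have h3 : ∀ t ≤ 0, Φ t = 0 := fun t ht => by
    by_contra h
    exact absurd (hΦsupp (subset_tsupport _ h)) (not_lt.mpr ht)
  have hint : ∫ t in Set.Ioi (0 : ℝ), Φ t = ∫ t, Φ t :=
    MeasureTheory.setIntegral_eq_integral_of_forall_compl_eq_zero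
      fun t ht => h3 t (not_lt.mp ht)
  obtain ⟨σ, hσ0, hσ1, hσε⟩ : ∃ σ : ℝ, 1 / 2 < σ ∧ σ ≤ 1 ∧ σ ≤ 1 / 2 + ε :=
    ⟨min 1 (1 / 2 + ε), lt_min (by norm_num) (by linarith), min_le_left _ _, min_le_right _ _⟩
  obtain ⟨C, hC, hbound⟩ := exists_norm_squarefree_character_sum_sub_le
    (Φ := fun t => (Φ t : ℂ)) (hΦcompact.comp_left Complex.ofReal_zero)
    (Complex.ofRealCLM.contDiff.comp hΦsmooth) (fun t ht => by rw [h3 t ht, Complex.ofReal_zero])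
    hk hσ0 hσ1
  refine ⟨C * 2 ^ ((1 - σ) / 2), by positivity, fun X hX n hn hodd => ?_⟩
  have : NeZero n := ⟨hn.ne'⟩
  have hX0 : 0 < X := by linarith
  have hn1 : (1 : ℝ) ≤ n := by exact_mod_cast hn
  have key := hbound (2 * n) (oddJacobiChar n) X hX0
  rw [prod_mul_tsum_coprime_squarefreeCoeff hk hodd] at key
  set Q := ∏ p ∈ n.primeFactors, (1 + A p ^ (-k) / (p : ℝ))⁻¹
  set E := ∏' p : {p : ℕ // p.Prime ∧ p ≠ 2},
    (1 - 1 / ((p : ℕ) : ℝ)) * (1 + A (p : ℕ) ^ (-k) / ((p : ℕ) : ℝ))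
  have hsum : ((∑' d : ℕ, (if Odd d ∧ Squarefree d then
      A d ^ (-k) * (chi8 d n : ℝ) * Φ ((d : ℝ) / X) else 0) : ℝ) : ℂ) =
      jacobiSym 8 n *
        ∑' d : ℕ, (squarefreeWeight k d : ℂ) * (oddJacobiChar n d * Φ (d / X)) := by
    rw [Complex.ofReal_tsum, ← tsum_mul_left]
    refine tsum_congr fun d => ?_
    rw [oddJacobiChar_natCast, squarefreeWeight_apply, chi8_eq hodd]
    by_cases h1 : Odd d <;> by_cases h2 : Squarefree d <;> simp [h1, h2]
    ring
  have hmain : (((if IsSquare n then (1 : ℝ) else 0) * (∫ t in Set.Ioi (0 : ℝ), Φ t) *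
      (X / 2) * Q * E : ℝ) : ℂ) = jacobiSym 8 n *
        ((if oddJacobiChar n = 1 then ∫ t, (Φ t : ℂ) else 0) * X * ((1 / 2 * Q * E : ℝ) : ℂ)) := by
    simp only [oddJacobiChar_eq_one_iff hodd]
    by_cases hsq : IsSquare n
    · have h8 : jacobiSym 8 n = 1 := by
        refine jacobiSym_of_isSquare hsq ?_
        change Nat.Coprime 8 n
        exact (Nat.coprime_two_left.mpr hodd).pow_left 3
      rw [if_pos hsq, if_pos hsq, hint, h8, integral_complex_ofReal]
      push_cast
      ring
    · simp [hsq]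
  have h8 : ‖(jacobiSym 8 n : ℂ)‖ ≤ 1 := by
    rcases jacobiSym.trichotomy 8 n with h | h | h <;> simp [h]
  rw [← Real.norm_eq_abs, ← Complex.norm_real, Complex.ofReal_sub, hsum, hmain, ← mul_sub,
    norm_mul]
  calc _ ≤ C * X ^ σ * ((2 * n : ℕ) : ℝ) ^ ((1 - σ) / 2) :=
        (mul_le_of_le_one_left (norm_nonneg _) h8).trans key
    _ = C * 2 ^ ((1 - σ) / 2) * X ^ σ * (n : ℝ) ^ ((1 - σ) / 2) := by
        rw [Nat.cast_mul, Real.mul_rpow (by positivity) (by positivity)]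
        push_cast
        ring
    _ ≤ _ := by
        gcongr
        linarith
end
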